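/- arXiv:2101.01354 — 2 statements merged into one kernel-verified Lean document; each statement's English description precedes it below -/
import Mathlib

section
/- Let G be a finite simple graph with maximum degree Δ(G) ≥ 9 that is P5-free, i.e., G contains no induced subgraph isomorphic to the path on 5 vertices. Then χ(G) ≤ max{Δ(G) − 1, ω(G)}. -/
open SimpleGraph

set_option linter.unusedSectionVars false
namespace BKP5
open Finset Classical

variable {V : Type*} [Fintype V] {G : SimpleGraph V} {k : ℕ}

/-- The neighbourhood of a vertex as a finset. -/
noncomputable def N (G : SimpleGraph V) (v : V) : Finset V := univ.filter (fun u => G.Adj v u)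

lemma mem_N {v u : V} : u ∈ N G v ↔ G.Adj v u := by simp [N]

/-- `φ` is a proper colouring outside of `X`. -/
def PC (G : SimpleGraph V) (X : Finset V) (φ : V → Fin k) : Prop :=
  ∀ x y, x ∉ X → y ∉ X → G.Adj x y → φ x ≠ φ y

/-- A vertex-critical counterexample. -/
structure BK (G : SimpleGraph V) (k : ℕ) : Prop where
  hk : 8 ≤ k
  hdeg : ∀ v, (N G v).card ≤ k + 1
  hP5 : ∀ a b c d e, G.Adj a b → G.Adj b c → G.Adj c d → G.Adj d e →
    ¬ G.Adj a c → ¬ G.Adj a d → ¬ G.Adj a e → ¬ G.Adj b d → ¬ G.Adj b e → ¬ G.Adj c e → False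
  hncol : ∀ φ : V → Fin k, ¬ PC G ∅ φ
  hcrit : ∀ v, ∃ φ : V → Fin k, PC G {v} φ
  hcl : ∀ s : Finset V, (∀ x ∈ s, ∀ y ∈ s, x ≠ y → G.Adj x y) → s.card ≤ k

/-- Counting colours on a finset. -/
lemma cnt (A : Finset V) (φ : V → Fin k) (M E : Finset (Fin k)) (hEM : E ⊆ M)
    (hM : ∀ m ∈ M, ∃ u ∈ A, φ u = m)
    (hE : ∀ m ∈ E, ∃ u ∈ A, ∃ u' ∈ A, u ≠ u' ∧ φ u = m ∧ φ u' = m) :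
    M.card + E.card ≤ A.card := by
  have h1 : A.card = ∑ m : Fin k, (A.filter (fun u => φ u = m)).card :=
    card_eq_sum_card_fiberwise (fun _ _ => by simp)
  have h2 : ∑ m ∈ M, (1 + if m ∈ E then 1 else 0) ≤ ∑ m ∈ M, (A.filter (fun u => φ u = m)).card := by
    apply sum_le_sum
    intro m hm
    split_ifs with h
    · obtain ⟨u, hu, u', hu', hne, h1, h2⟩ := hE m h
      have : 1 < (A.filter (fun u => φ u = m)).card :=
        one_lt_card.2 ⟨u, by simp [hu, h1], u', by simp [hu', h2], hne⟩
      omega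
    · obtain ⟨u, hu, h1⟩ := hM m hm
      have : 0 < (A.filter (fun u => φ u = m)).card := card_pos.2 ⟨u, by simp [hu, h1]⟩
      omega
  have h3 : ∑ m ∈ M, (A.filter (fun u => φ u = m)).card ≤
      ∑ m : Fin k, (A.filter (fun u => φ u = m)).card :=
    sum_le_sum_of_subset (subset_univ _)
  have h4 : ∑ m ∈ M, (1 + if m ∈ E then 1 else 0) = M.card + E.card := by
    rw [sum_add_distrib, ← sum_filter, filter_mem_eq_inter, inter_eq_right.2 hEM]; simp
  omega

lemma upd {X X' : Finset V} {φ : V → Fin k} (h : PC G X φ) (s : V) (m : Fin k)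
    (hX : X ⊆ insert s X') (hs : ∀ y, y ∉ X' → y ≠ s → G.Adj s y → φ y ≠ m) :
    PC G X' (Function.update φ s m) := by
  intro x y hx hy hxy
  have hX1 : ∀ z, z ∉ X' → z ≠ s → z ∉ X := fun z hz hzs hzX => by
    have := hX hzX
    simp_all
  by_cases h1 : x = s
  · subst h1
    have : y ≠ x := hxy.ne'
    simp only [Function.update_self, Function.update_of_ne this]
    exact (hs y hy this hxy).symm
  · by_cases h2 : y = s
    · subst h2
      simp only [Function.update_self, Function.update_of_ne h1]
      exact hs x hx h1 hxy.symm
    · simp only [Function.update_of_ne h1, Function.update_of_ne h2]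
      exact h x y (hX1 x hx h1) (hX1 y hy h2) hxy

lemma seesHole (H : BK G k) {v : V} {φ : V → Fin k} (h : PC G {v} φ) (m : Fin k) :
    ∃ u, G.Adj v u ∧ φ u = m := by
  by_contra hc
  push Not at hc
  exact H.hncol _ (upd (X' := ∅) h v m (by simp) (fun y _ _ hy => hc y hy))

lemma moveHole {v a : V} {φ : V → Fin k} (h : PC G {v} φ)
    (hu : ∀ u, G.Adj v u → φ u = φ a → u = a) : PC G {a} (Function.update φ v (φ a)) :=
  upd h v (φ a) (by simp) (fun y hy _ hvy hc => by
    have := hu y hvy hc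
    simp_all)

lemma seesNbr (H : BK G k) {v a : V} {φ : V → Fin k} (h : PC G {v} φ)
    (hu : ∀ u, G.Adj v u → φ u = φ a → u = a) (m : Fin k) (hm : m ≠ φ a) :
    ∃ u, u ≠ v ∧ G.Adj a u ∧ φ u = m := by
  obtain ⟨u, hu1, hu2⟩ := seesHole H (moveHole h hu) m
  by_cases huv : u = v
  · subst huv
    simp at hu2
    exact absurd hu2.symm hm
  · rw [Function.update_of_ne huv] at hu2
    exact ⟨u, huv, hu1, hu2⟩

lemma kempe (H : BK G k) {v a b : V} {φ : V → Fin k} (h : PC G {v} φ)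
    (hva : G.Adj v a) (hvb : G.Adj v b)
    (hua : ∀ u, G.Adj v u → φ u = φ a → u = a)
    (hub : ∀ u, G.Adj v u → φ u = φ b → u = b)
    (hne : φ a ≠ φ b) (hab : ¬ G.Adj a b) :
    ∃ x y, x ≠ v ∧ y ≠ v ∧ φ x = φ b ∧ φ y = φ a ∧ G.Adj a x ∧ G.Adj x y ∧ G.Adj y b := by
  by_contra hc
  push Not at hc
  have hp : ∀ x y, x ≠ v → y ≠ v → G.Adj x y → φ x ≠ φ y := fun x y hx hy =>
    h x y (by simpa using hx) (by simpa using hy)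
  have hav : a ≠ v := hva.ne'
  have hbv : b ≠ v := hvb.ne'
  -- the component
  let L1 : V → Prop := fun x => x ≠ v ∧ φ x = φ b ∧ G.Adj a x
  let L2 : V → Prop := fun y => y ≠ v ∧ φ y = φ a ∧ (y = a ∨ ∃ x, L1 x ∧ G.Adj x y)
  let L3 : V → Prop := fun t => t ≠ v ∧ φ t = φ b ∧ ∃ y, L2 y ∧ G.Adj y t
  let S : V → Prop := fun u => L2 u ∨ L3 u
  have hbS : ¬ S b := by
    rintro (⟨_, h2, _⟩ | ⟨_, _, y, ⟨hy1, hy2, rfl | ⟨x, ⟨hx1, hx2, hx3⟩, hxy⟩⟩, hyb⟩)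
    · exact hne h2.symm
    · exact hab hyb
    · exact hc x y hx1 hy1 hx2 hy2 hx3 hxy hyb
  have haS : S a := Or.inl ⟨hav, rfl, Or.inl rfl⟩
  have hcl1 : ∀ x y, S x → y ≠ v → φ y = φ a → G.Adj x y → S y := by
    rintro x z (⟨hx1, hx2, _⟩ | ⟨ht1, ht2, y, ⟨hy1, hy2, rfl | ⟨x', ⟨hx1, hx2, hx3⟩, hxy⟩⟩, hyt⟩) hz hz2 hxz
    · exact absurd (hx2.trans hz2.symm) (hp _ _ hx1 hz hxz)
    · exact Or.inl ⟨hz, hz2, Or.inr ⟨x, ⟨ht1, ht2, hyt⟩, hxz⟩⟩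
    · by_cases h1 : G.Adj a x
      · exact Or.inl ⟨hz, hz2, Or.inr ⟨x, ⟨ht1, ht2, h1⟩, hxz⟩⟩
      by_cases h2 : G.Adj x' z
      · exact Or.inl ⟨hz, hz2, Or.inr ⟨x', ⟨hx1, hx2, hx3⟩, h2⟩⟩
      exfalso
      exact H.hP5 a x' y x z hx3 hxy hyt hxz
        (fun e => hp _ _ hav hy1 e hy2.symm) h1 (fun e => hp _ _ hav hz e hz2.symm)
        (fun e => hp _ _ hx1 ht1 e (hx2.trans ht2.symm)) h2
        (fun e => hp _ _ hy1 hz e (hy2.trans hz2.symm))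
  have hcl2 : ∀ x y, S x → y ≠ v → φ y = φ b → G.Adj x y → S y := by
    rintro x z (hx | ⟨ht1, ht2, _⟩) hz hz2 hxz
    · exact Or.inr ⟨hz, hz2, x, hx, hxz⟩
    · exact absurd (ht2.trans hz2.symm) (hp _ _ ht1 hz hxz)
  have hSc : ∀ x, S x → φ x = φ a ∨ φ x = φ b := by
    rintro x (⟨_, h2, _⟩ | ⟨_, h2, _⟩)
    · exact Or.inl h2
    · exact Or.inr h2
  let ψ : V → Fin k := fun u => if S u then (if φ u = φ a then φ b else φ a) else φ u
  have hψ : PC G {v} ψ := by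
    intro x y hx hy hxy
    have hx' : x ≠ v := by simpa using hx
    have hy' : y ≠ v := by simpa using hy
    have h1 := hp x y hx' hy' hxy
    simp only [ψ]
    by_cases hSx : S x <;> by_cases hSy : S y
    · rw [if_pos hSx, if_pos hSy]
      split_ifs with e f f
      · exact absurd (e.trans f.symm) h1
      · exact hne.symm
      · exact hne
      · have e' := (hSc x hSx).resolve_left e
        have f' := (hSc y hSy).resolve_left f
        exact absurd (e'.trans f'.symm) h1
    · rw [if_pos hSx, if_neg hSy]
      have h2 : φ y ≠ φ a := fun e => hSy (hcl1 x y hSx hy' e hxy)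
      have h3 : φ y ≠ φ b := fun e => hSy (hcl2 x y hSx hy' e hxy)
      split_ifs
      · exact h3.symm
      · exact h2.symm
    · rw [if_neg hSx, if_pos hSy]
      have h2 : φ x ≠ φ a := fun e => hSx (hcl1 y x hSy hx' e hxy.symm)
      have h3 : φ x ≠ φ b := fun e => hSx (hcl2 y x hSy hx' e hxy.symm)
      split_ifs
      · exact h3
      · exact h2
    · rw [if_neg hSx, if_neg hSy]
      exact h1
  obtain ⟨u, hu1, hu2⟩ := seesHole H hψ (φ a)
  simp only [ψ] at hu2
  split_ifs at hu2 with h1 h2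
  · exact hne hu2.symm
  · have := hSc u h1
    have h3 : φ u = φ b := by tauto
    have := hub u hu1 h3
    subst this
    exact hbS h1
  · have := hua u hu1 hu2
    subst this
    exact h1 haS

lemma kempeComplete (H : BK G k) {v a b : V} {φ : V → Fin k} (h : PC G {v} φ)
    (hva : G.Adj v a) (hvb : G.Adj v b)
    (hua : ∀ u, G.Adj v u → φ u = φ a → u = a)
    (hub : ∀ u, G.Adj v u → φ u = φ b → u = b)
    (hne : φ a ≠ φ b) (hab : ¬ G.Adj a b) {p q : V} (hpv : p ≠ v) (hqv : q ≠ v)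
    (hp1 : φ p = φ b) (hq1 : φ q = φ a) (hap : G.Adj a p) (hbq : G.Adj b q) : G.Adj p q := by
  obtain ⟨x, y, hx, hy, hx1, hy1, hax, hxy, hyb⟩ := kempe H h hva hvb hua hub hne hab
  have hp : ∀ x y, x ≠ v → y ≠ v → φ x = φ y → ¬ G.Adj x y := fun x y hx hy e f =>
    h x y (by simpa using hx) (by simpa using hy) f e
  have hav : a ≠ v := hva.ne'
  have hbv : b ≠ v := hvb.ne'
  have hpy : G.Adj p y := by
    by_contra hc
    exact H.hP5 p a x y b hap.symm hax hxy hyb (hp _ _ hpv hx (by simp_all)) hc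
      (hp _ _ hpv hbv (by simp_all)) (hp _ _ hav hy (by simp_all)) hab (hp _ _ hx hbv (by simp_all))
  by_contra hc
  exact H.hP5 a p y b q hap hpy hyb hbq (hp _ _ hav hy (by simp_all)) hab
    (hp _ _ hav hqv (by simp_all)) (hp _ _ hpv hbv (by simp_all)) hc (hp _ _ hy hqv (by simp_all))

end BKP5

set_option linter.unusedSectionVars false
namespace BKP5
open Finset Classical
variable {V : Type*} [Fintype V] {G : SimpleGraph V} {k : ℕ}

/-- Possible partitions of the five-cycle `0,1,2,3,4` into admissible parts. -/
lemma partC5 {x0 x1 x2 x3 x4 : V}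
    (s0 : x0 = x1 ∨ x0 = x2 ∨ x0 = x3 ∨ x0 = x4)
    (s1 : x1 = x0 ∨ x1 = x2 ∨ x1 = x3 ∨ x1 = x4)
    (s2 : x2 = x0 ∨ x2 = x1 ∨ x2 = x3 ∨ x2 = x4)
    (s3 : x3 = x0 ∨ x3 = x1 ∨ x3 = x2 ∨ x3 = x4)
    (s4 : x4 = x0 ∨ x4 = x1 ∨ x4 = x2 ∨ x4 = x3)
    (p01 : x0 = x1 → x0 = x2 ∨ x0 = x3 ∨ x0 = x4)
    (p12 : x1 = x2 → x1 = x0 ∨ x1 = x3 ∨ x1 = x4)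
    (p23 : x2 = x3 → x2 = x0 ∨ x2 = x1 ∨ x2 = x4)
    (p34 : x3 = x4 → x3 = x0 ∨ x3 = x1 ∨ x3 = x2)
    (p40 : x4 = x0 → x4 = x1 ∨ x4 = x2 ∨ x4 = x3) :
    (x0 = x1 ∧ x0 = x2 ∧ x0 = x3 ∧ x0 = x4) ∨
    (x0 ≠ x1 ∧ x0 = x2 ∧ x1 = x3 ∧ x1 = x4) ∨
    (x0 ≠ x1 ∧ x1 = x3 ∧ x0 = x4 ∧ x0 = x2) ∨
    (x0 ≠ x2 ∧ x2 = x4 ∧ x0 = x1 ∧ x0 = x3) ∨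
    (x0 ≠ x1 ∧ x3 = x0 ∧ x1 = x2 ∧ x1 = x4) ∨
    (x0 ≠ x1 ∧ x4 = x1 ∧ x0 = x2 ∧ x0 = x3) := by
  by_cases a : x0 = x1 <;> by_cases b : x0 = x2 <;> by_cases c : x0 = x3 <;>
    by_cases d : x0 = x4 <;> grind

/-- In a vertex `w` with a colour seen twice, bad colours are rare. -/
lemma core (H : BK G k) {v a b : V} {φ : V → Fin k} (h : PC G {v} φ)
    (hva : G.Adj v a) (hvb : G.Adj v b)
    (hua : ∀ u, G.Adj v u → φ u = φ a → u = a)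
    (hub : ∀ u, G.Adj v u → φ u = φ b → u = b)
    (hne : φ a ≠ φ b) (hab : ¬ G.Adj a b)
    (hA : ∀ p, p ≠ v → G.Adj a p → φ p = φ b → ∀ m, m ≠ φ b → ∃ u, u ≠ v ∧ G.Adj p u ∧ φ u = m)
    (hB : ∀ q, q ≠ v → G.Adj b q → φ q = φ a → ∀ m, m ≠ φ a → ∃ u, u ≠ v ∧ G.Adj q u ∧ φ u = m)
    (hcard : (univ.filter (fun q => q ≠ v ∧ G.Adj b q ∧ φ q = φ a)).card ≤
      (univ.filter (fun p => p ≠ v ∧ G.Adj a p ∧ φ p = φ b)).card) : False := by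
  have hav : a ≠ v := hva.ne'
  have hbv : b ≠ v := hvb.ne'
  have hp : ∀ x y, x ≠ v → y ≠ v → φ x = φ y → ¬ G.Adj x y := fun x y hx hy e f =>
    h x y (by simpa using hx) (by simpa using hy) f e
  obtain ⟨p, q, hpv, hqv, hpc, hqc, hap, hpq, hqb⟩ := kempe H h hva hvb hua hub hne hab
  have hvp : ¬ G.Adj v p := fun e => by
    have := hub p e hpc
    subst this
    exact hab hap
  have hvq : ¬ G.Adj v q := fun e => by
    have := hua q e hqc
    subst this
    exact hab hqb
  have hpb : ¬ G.Adj p b := hp _ _ hpv hbv hpc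
  have haq : ¬ G.Adj a q := hp _ _ hav hqv hqc.symm
  have hk := H.hk
  -- bad colours
  let bad : V → Finset (Fin k) := fun w => univ.filter (fun m => m ≠ φ a ∧ m ≠ φ b ∧
    ∃ u, ∃ u', u ≠ u' ∧ u ≠ v ∧ u' ≠ v ∧ G.Adj w u ∧ G.Adj w u' ∧ φ u = m ∧ φ u' = m)
  have bv : (bad v).card ≤ 1 := by
    have := cnt (N G v) φ univ (bad v) (subset_univ _)
      (fun m _ => by
        obtain ⟨u, h1, h2⟩ := seesHole H h m
        exact ⟨u, mem_N.2 h1, h2⟩)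
      (fun m hm => by
        obtain ⟨-, -, -, u, u', h1, -, -, h2, h3, h4, h5⟩ := mem_filter.1 hm
        exact ⟨u, mem_N.2 h2, u', mem_N.2 h3, h1, h4, h5⟩)
    have h2 := H.hdeg v
    simp at this
    omega
  have bnb : ∀ w, G.Adj v w → (∀ u, G.Adj v u → φ u = φ w → u = w) → (φ w = φ a ∨ φ w = φ b) →
      (bad w).card ≤ 1 := by
    intro w hw huw hwc
    have := cnt ((N G w).erase v) φ (univ.erase (φ w)) (bad w)
      (fun m hm => by
        obtain ⟨-, h1, h2, -⟩ := mem_filter.1 hm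
        rcases hwc with e | e <;> simp [e, h1, h2])
      (fun m hm => by
        obtain ⟨u, h1, h2, h3⟩ := seesNbr H h huw m (ne_of_mem_erase hm)
        exact ⟨u, mem_erase.2 ⟨h1, mem_N.2 h2⟩, h3⟩)
      (fun m hm => by
        obtain ⟨-, -, -, u, u', h1, h6, h7, h2, h3, h4, h5⟩ := mem_filter.1 hm
        exact ⟨u, mem_erase.2 ⟨h6, mem_N.2 h2⟩, u', mem_erase.2 ⟨h7, mem_N.2 h3⟩, h1, h4, h5⟩)
    have h2 := H.hdeg w
    rw [card_erase_of_mem (mem_univ _), card_erase_of_mem (mem_N.2 hw.symm)] at this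
    simp at this
    omega
  have b2 : ∀ w c, (φ w = φ a ∧ c = φ b ∨ φ w = φ b ∧ c = φ a) →
      (∀ m, m ≠ φ w → ∃ u, u ≠ v ∧ G.Adj w u ∧ φ u = m) →
      (∃ u u', u ≠ u' ∧ G.Adj w u ∧ G.Adj w u' ∧ φ u = c ∧ φ u' = c) → (bad w).card ≤ 1 := by
    intro w c hwc hsee htw
    have hcb : c ∉ bad w := fun hm => by
      obtain ⟨-, h1, h2, -⟩ := mem_filter.1 hm
      rcases hwc with ⟨_, e⟩ | ⟨_, e⟩
      · exact h2 e
      · exact h1 e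
    have := cnt (N G w) φ (univ.erase (φ w)) (insert c (bad w))
      (fun m hm => by
        rcases mem_insert.1 hm with rfl | hm
        · rcases hwc with ⟨e, f⟩ | ⟨e, f⟩ <;> simp [e, f, hne, hne.symm]
        obtain ⟨-, h1, h2, -⟩ := mem_filter.1 hm
        rcases hwc with ⟨e, _⟩ | ⟨e, _⟩ <;> simp [e, h1, h2])
      (fun m hm => by
        obtain ⟨u, h1, h2, h3⟩ := hsee m (ne_of_mem_erase hm)
        exact ⟨u, mem_N.2 h2, h3⟩)
      (fun m hm => by
        rcases mem_insert.1 hm with rfl | hm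
        · obtain ⟨u, u', h1, h2, h3, h4, h5⟩ := htw
          exact ⟨u, mem_N.2 h2, u', mem_N.2 h3, h1, h4, h5⟩
        obtain ⟨-, -, -, u, u', h1, h6, h7, h2, h3, h4, h5⟩ := mem_filter.1 hm
        exact ⟨u, mem_N.2 h2, u', mem_N.2 h3, h1, h4, h5⟩)
    have h2 := H.hdeg w
    rw [card_erase_of_mem (mem_univ _), card_insert_of_notMem hcb] at this
    simp at this
    omega
  have ba := bnb a hva hua (Or.inl rfl)
  have bb := bnb b hvb hub (Or.inr rfl)
  have bp := b2 p (φ a) (Or.inr ⟨hpc, rfl⟩)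
    (fun m hm => hA p hpv hap hpc m (by rwa [hpc] at hm))
    ⟨a, q, fun e => hab (e ▸ hqb), hap.symm, hpq, rfl, hqc⟩
  have bq := b2 q (φ b) (Or.inl ⟨hqc, rfl⟩)
    (fun m hm => hB q hqv hqb.symm hqc m (by rwa [hqc] at hm))
    ⟨b, p, fun e => hab (e ▸ hap), hqb, hpq.symm, rfl, hpc⟩
  obtain ⟨l, hl⟩ : ∃ l, l ∉ insert (φ a) (insert (φ b)
      (bad v ∪ (bad a ∪ (bad p ∪ (bad q ∪ bad b))))) := by
    by_contra hc
    push Not at hc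
    have h1 : (univ : Finset (Fin k)).card ≤ _ := card_le_card (fun m _ => hc m)
    have i1 := card_insert_le (φ a) (insert (φ b)
      (bad v ∪ (bad a ∪ (bad p ∪ (bad q ∪ bad b)))))
    have i2 := card_insert_le (φ b)
      (bad v ∪ (bad a ∪ (bad p ∪ (bad q ∪ bad b))))
    have i3 := card_union_le (bad v) (bad a ∪ (bad p ∪ (bad q ∪ bad b)))
    have i4 := card_union_le (bad a) (bad p ∪ (bad q ∪ bad b))
    have i5 := card_union_le (bad p) (bad q ∪ bad b)
    have i6 := card_union_le (bad q) (bad b)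
    simp only [card_univ, Fintype.card_fin] at h1
    omega
  simp only [mem_insert, mem_union, not_or] at hl
  obtain ⟨hla, hlb, nv, na, np, nq, nb⟩ := hl
  have ub : ∀ w, l ∉ bad w → ∀ u u', u ≠ v → u' ≠ v → G.Adj w u → G.Adj w u' →
      φ u = l → φ u' = l → u = u' := by
    intro w hw u u' h1 h2 h3 h4 h5 h6
    by_contra hc
    exact hw (mem_filter.2 ⟨mem_univ _, hla, hlb, u, u', hc, h1, h2, h3, h4, h5, h6⟩)
  obtain ⟨x0, h0, c0⟩ := seesHole H h l
  have n0 : x0 ≠ v := h0.ne'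
  obtain ⟨x1, n1, h1, c1⟩ := seesNbr H h hua l hla
  obtain ⟨x2, n2, h2, c2⟩ := hA p hpv hap hpc l hlb
  obtain ⟨x3, n3, h3, c3⟩ := hB q hqv hqb.symm hqc l hla
  obtain ⟨x4, n4, h4, c4⟩ := seesNbr H h hub l hlb
  -- adjacency is equality
  have e0 : ∀ u, u ≠ v → φ u = l → G.Adj v u → x0 = u := fun u hu hc hw =>
    ub v nv x0 u n0 hu h0 hw c0 hc
  have e1 : ∀ u, u ≠ v → φ u = l → G.Adj a u → x1 = u := fun u hu hc hw =>
    ub a na x1 u n1 hu h1 hw c1 hc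
  have e2 : ∀ u, u ≠ v → φ u = l → G.Adj p u → x2 = u := fun u hu hc hw =>
    ub p np x2 u n2 hu h2 hw c2 hc
  have e3 : ∀ u, u ≠ v → φ u = l → G.Adj q u → x3 = u := fun u hu hc hw =>
    ub q nq x3 u n3 hu h3 hw c3 hc
  have e4 : ∀ u, u ≠ v → φ u = l → G.Adj b u → x4 = u := fun u hu hc hw =>
    ub b nb x4 u n4 hu h4 hw c4 hc
  have P5 := H.hP5
  have hl0 : ∀ x y, x ≠ v → y ≠ v → φ x = l → φ y = l → ¬ G.Adj x y :=
    fun x y h1 h2 h3 h4 => hp x y h1 h2 (h3.trans h4.symm)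
  -- z fact
  have zf : ∀ z u u', z ≠ v → φ z = φ a → z ≠ q → u ≠ u' → u ≠ v → u' ≠ v → φ u = l → φ u' = l →
      G.Adj z u → G.Adj z u' →
      ¬ G.Adj z v ∧ ¬ G.Adj z a ∧ ¬ G.Adj z p ∧ ¬ G.Adj z q ∧ ¬ G.Adj z b := by
    intro z u u' hzv hzc hzq huu huv huv' huc huc' hzu hzu'
    have z0 : ¬ G.Adj z v := fun e => by
      have := hua z e.symm hzc
      subst this
      exact huu (ub z na u u' huv huv' hzu hzu' huc huc')
    have z1 : ¬ G.Adj z a := hp _ _ hzv hav hzc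
    have z3 : ¬ G.Adj z q := hp _ _ hzv hqv (hzc.trans hqc.symm)
    have z4 : ¬ G.Adj z b := by
      intro hzb
      have hB2 : 1 < (univ.filter (fun q => q ≠ v ∧ G.Adj b q ∧ φ q = φ a)).card :=
        one_lt_card.2 ⟨z, by simp [hzv, hzb.symm, hzc], q, by simp [hqv, hqb.symm, hqc], hzq⟩
      obtain ⟨p', hp', hpp⟩ := exists_mem_ne (lt_of_lt_of_le hB2 hcard) p
      simp only [mem_filter, mem_univ, true_and] at hp'
      obtain ⟨hpv', hap', hpc'⟩ := hp'
      have hpz := kempeComplete H h hva hvb hua hub hne hab hpv hzv hpc hzc hap hzb.symm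
      have hpz' := kempeComplete H h hva hvb hua hub hne hab hpv' hzv hpc' hzc hap' hzb.symm
      have hpb1 : p ≠ b := fun e => hab (e ▸ hap)
      have hpb2 : p' ≠ b := fun e => hab (e ▸ hap')
      have hlb1 : ∀ x, φ x = l → x ≠ b := fun x hx e => hlb (by rw [← hx, e])
      have := cnt ((N G z).erase b) φ (univ.erase (φ a)) {φ b, l}
        (fun m hm => by
          rcases mem_insert.1 hm with rfl | hm
          · simp [hne.symm]
          · rw [mem_singleton.1 hm]
            simp [hla])
        (fun m hm => by
          by_cases hmb : m = φ b
          · exact ⟨p, mem_erase.2 ⟨hpb1, mem_N.2 hpz.symm⟩, by rw [hpc, hmb]⟩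
          obtain ⟨u, h1, h2, h3⟩ := hB z hzv hzb.symm hzc m (ne_of_mem_erase hm)
          refine ⟨u, mem_erase.2 ⟨fun e => hmb ?_, mem_N.2 h2⟩, h3⟩
          rw [← h3, e])
        (fun m hm => by
          rcases mem_insert.1 hm with rfl | hm
          · exact ⟨p, mem_erase.2 ⟨hpb1, mem_N.2 hpz.symm⟩, p',
              mem_erase.2 ⟨hpb2, mem_N.2 hpz'.symm⟩, hpp.symm, hpc, hpc'⟩
          · rw [mem_singleton.1 hm]
            exact ⟨u, mem_erase.2 ⟨hlb1 u huc, mem_N.2 hzu⟩, u',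
              mem_erase.2 ⟨hlb1 u' huc', mem_N.2 hzu'⟩, huu, huc, huc'⟩)
      have h2 := H.hdeg z
      rw [card_erase_of_mem (mem_univ _), card_erase_of_mem (mem_N.2 hzb),
        card_pair (fun e => hlb e.symm)] at this
      simp at this
      omega
    refine ⟨z0, z1, fun z2 => ?_, z3, z4⟩
    exact P5 z p a v b z2 hap.symm hva.symm hvb z1 z0 z4 (fun e => hvp e.symm) hpb hab
  have kf : x0 ≠ x1 → ∃ z, G.Adj z x0 ∧ G.Adj z x1 ∧
      ¬ G.Adj z v ∧ ¬ G.Adj z a ∧ ¬ G.Adj z p ∧ ¬ G.Adj z q ∧ ¬ G.Adj z b := by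
    intro h01
    obtain ⟨x, y, hx, hy, hxc, hyc, hax, hxy, hyx0⟩ := kempe H h hva h0 hua
      (fun u hu hc => (e0 u hu.ne' (hc.trans c0) hu).symm) (by rw [c0]; exact fun e => hla e.symm)
      (fun e => h01 (e1 x0 n0 c0 e).symm)
    have := e1 x hx (hxc.trans c0) hax
    subst this
    refine ⟨y, hyx0, hxy.symm, zf y x0 x1 hy hyc (fun e => ?_) h01 n0 n1 c0 c1 hyx0 hxy.symm⟩
    subst e
    exact h01 ((e3 x0 n0 c0 hyx0).symm.trans (e3 x1 n1 c1 hxy.symm))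
  have g0 : ∀ u, u ≠ v → φ u = l → u ≠ x0 → ¬ G.Adj u v := fun u hu hc hx e =>
    hx (e0 u hu hc e.symm).symm
  have g1 : ∀ u, u ≠ v → φ u = l → u ≠ x1 → ¬ G.Adj u a := fun u hu hc hx e =>
    hx (e1 u hu hc e.symm).symm
  have g2 : ∀ u, u ≠ v → φ u = l → u ≠ x2 → ¬ G.Adj u p := fun u hu hc hx e =>
    hx (e2 u hu hc e.symm).symm
  have g3 : ∀ u, u ≠ v → φ u = l → u ≠ x3 → ¬ G.Adj u q := fun u hu hc hx e =>
    hx (e3 u hu hc e.symm).symm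
  have g4 : ∀ u, u ≠ v → φ u = l → u ≠ x4 → ¬ G.Adj u b := fun u hu hc hx e =>
    hx (e4 u hu hc e.symm).symm
  have key := partC5 (x0 := x0) (x1 := x1) (x2 := x2) (x3 := x3) (x4 := x4)
    (by
      by_contra hc
      push Not at hc
      obtain ⟨t1, t2, t3, t4⟩ := hc
      exact P5 x0 v a p q h0.symm hva hap hpq (g1 x0 n0 c0 t1)
        (g2 x0 n0 c0 t2) (g3 x0 n0 c0 t3) hvp hvq haq)
    (by
      by_contra hc
      push Not at hc
      obtain ⟨t0, t2, t3, t4⟩ := hc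
      exact P5 x1 a p q b h1.symm hap hpq hqb (g2 x1 n1 c1 t2)
        (g3 x1 n1 c1 t3) (g4 x1 n1 c1 t4) haq hab hpb)
    (by
      by_contra hc
      push Not at hc
      obtain ⟨t0, t1, t3, t4⟩ := hc
      exact P5 x2 p q b v h2.symm hpq hqb hvb.symm (g3 x2 n2 c2 t3)
        (g4 x2 n2 c2 t4) (g0 x2 n2 c2 t0) hpb (fun e => hvp e.symm) (fun e => hvq e.symm))
    (by
      by_contra hc
      push Not at hc
      obtain ⟨t0, t1, t2, t4⟩ := hc
      exact P5 x3 q b v a h3.symm hqb hvb.symm hva (g4 x3 n3 c3 t4)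
        (g0 x3 n3 c3 t0) (g1 x3 n3 c3 t1) (fun e => hvq e.symm) (fun e => haq e.symm) (fun e => hab e.symm))
    (by
      by_contra hc
      push Not at hc
      obtain ⟨t0, t1, t2, t3⟩ := hc
      exact P5 x4 b v a p h4.symm hvb.symm hva hap (g0 x4 n4 c4 t0)
        (g1 x4 n4 c4 t1) (g2 x4 n4 c4 t2) (fun e => hab e.symm) (fun e => hpb e.symm) hvp)
    (by
      intro hij
      by_contra hc
      push Not at hc
      obtain ⟨t2, t3, t4⟩ := hc
      exact P5 x0 a p q b (hij ▸ h1.symm) hap hpq hqb (g2 x0 n0 c0 t2)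
        (g3 x0 n0 c0 t3) (g4 x0 n0 c0 t4) haq hab hpb)
    (by
      intro hij
      by_contra hc
      push Not at hc
      obtain ⟨t0, t3, t4⟩ := hc
      exact P5 x1 p q b v (hij ▸ h2.symm) hpq hqb hvb.symm (g3 x1 n1 c1 t3)
        (g4 x1 n1 c1 t4) (g0 x1 n1 c1 t0) hpb (fun e => hvp e.symm) (fun e => hvq e.symm))
    (by
      intro hij
      by_contra hc
      push Not at hc
      obtain ⟨t0, t1, t4⟩ := hc
      exact P5 x2 q b v a (hij ▸ h3.symm) hqb hvb.symm hva (g4 x2 n2 c2 t4)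
        (g0 x2 n2 c2 t0) (g1 x2 n2 c2 t1) (fun e => hvq e.symm) (fun e => haq e.symm) (fun e => hab e.symm))
    (by
      intro hij
      by_contra hc
      push Not at hc
      obtain ⟨t0, t1, t2⟩ := hc
      exact P5 x3 b v a p (hij ▸ h4.symm) hvb.symm hva hap (g0 x3 n3 c3 t0)
        (g1 x3 n3 c3 t1) (g2 x3 n3 c3 t2) (fun e => hab e.symm) (fun e => hpb e.symm) hvp)
    (by
      intro hij
      by_contra hc
      push Not at hc
      obtain ⟨t1, t2, t3⟩ := hc
      exact P5 x4 v a p q (hij ▸ h0.symm) hva hap hpq (g1 x4 n4 c4 t1)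
        (g2 x4 n4 c4 t2) (g3 x4 n4 c4 t3) hvp hvq haq)
  rcases key with ⟨k1, k2, k3, k4⟩ | ⟨hn, k2, k3, k4⟩ | ⟨hn, k2, k3, k4⟩ | ⟨hn, k2, k3, k4⟩ |
    ⟨hn, k2, k3, k4⟩ | ⟨hn, k2, k3, k4⟩
  · -- complete vertex
    subst k1 k2 k3 k4
    have hm := moveHole h (a := x0) (fun u hu hc => (e0 u hu.ne' (hc.trans c0) hu).symm)
    have := cnt (N G x0) (Function.update φ v (φ x0)) univ {φ a, φ b} (subset_univ _)
      (fun m _ => by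
        obtain ⟨u, h1, h2⟩ := seesHole H hm m
        exact ⟨u, mem_N.2 h1, h2⟩)
      (fun m hm => by
        rcases mem_insert.1 hm with rfl | hm
        · exact ⟨a, mem_N.2 h1.symm, q, mem_N.2 h3.symm, fun e => hab (e ▸ hqb),
            by rw [Function.update_of_ne hav], by rw [Function.update_of_ne hqv, hqc]⟩
        · rw [mem_singleton.1 hm]
          exact ⟨b, mem_N.2 h4.symm, p, mem_N.2 h2.symm, fun e => hab (e ▸ hap),
            by rw [Function.update_of_ne hbv], by rw [Function.update_of_ne hpv, hpc]⟩)
    have h2 := H.hdeg x0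
    rw [card_pair hne] at this
    simp at this
    omega
  · subst k2 k3 k4
    obtain ⟨z, y0, y1, z0, z1, z2, z3, z4⟩ := kf hn
    exact P5 z x0 v b q y0 h0.symm hvb hqb.symm z0 z4 z3 (g4 x0 n0 c0 hn) (g3 x0 n0 c0 hn) hvq
  · subst k2 k3 k4
    exact P5 q x1 a v x0 h3 h1.symm hva.symm h0 (fun e => haq e.symm) (fun e => hvq e.symm)
      (fun e => hn (e3 x0 n0 c0 e).symm) (g0 x1 n1 c1 hn.symm) (hl0 _ _ n1 n0 c1 c0)
      (fun e => hn (e1 x0 n0 c0 e).symm)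
  · subst k2 k3 k4
    exact P5 p x2 b v x0 h2 h4.symm hvb.symm h0 hpb (fun e => hvp e.symm)
      (fun e => hn (e2 x0 n0 c0 e).symm) (g0 x2 n2 c2 hn.symm) (hl0 _ _ n2 n0 c2 c0)
      (fun e => hn (e4 x0 n0 c0 e).symm)
  · subst k2 k3 k4
    obtain ⟨z, y0, y1, z0, z1, z2, z3, z4⟩ := kf hn
    exact P5 z x3 v a p y0 h0.symm hva hap z0 z1 z2 (g1 x3 n0 c0 hn) (g2 x3 n0 c0 hn) hvp
  · subst k2 k3 k4
    obtain ⟨z, y0, y1, z0, z1, z2, z3, z4⟩ := kf hn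
    exact P5 z x4 b q p y1 h4.symm hqb.symm hpq.symm z4 z3 z2 (g3 x4 n4 c4 hn.symm)
      (g2 x4 n4 c4 hn.symm) (fun e => hpb e.symm)

end BKP5

set_option linter.unusedSectionVars false
namespace BKP5
open Finset Classical
variable {V : Type*} [Fintype V] {G : SimpleGraph V} {k : ℕ}

/-- Recolouring a vertex of `A` decreases `|A| + |B|`. -/
lemma step {v a b : V} {φ : V → Fin k} (h : PC G {v} φ)
    (hub : ∀ u, G.Adj v u → φ u = φ b → u = b)
    (hab : ¬ G.Adj a b) (p : V) (hpv : p ≠ v) (hap : G.Adj a p) (hpc : φ p = φ b)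
    (hav : a ≠ v) (m : Fin k) (hm : m ≠ φ b) (hno : ∀ u, u ≠ v → G.Adj p u → φ u ≠ m) :
    ∃ ψ : V → Fin k, PC G {v} ψ ∧ ψ a = φ a ∧ ψ b = φ b ∧ (∀ u, G.Adj v u → ψ u = φ u) ∧
      (univ.filter (fun x => x ≠ v ∧ G.Adj a x ∧ ψ x = ψ b)).card <
        (univ.filter (fun x => x ≠ v ∧ G.Adj a x ∧ φ x = φ b)).card ∧
      (univ.filter (fun x => x ≠ v ∧ G.Adj b x ∧ ψ x = ψ a)).card ≤
        (univ.filter (fun x => x ≠ v ∧ G.Adj b x ∧ φ x = φ a)).card := by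
  have hpa : a ≠ p := hap.ne
  have hpb : b ≠ p := fun e => hab (e ▸ hap)
  have hma : φ a ≠ m := hno a hav hap.symm
  have ha : Function.update φ p m a = φ a := Function.update_of_ne hpa _ _
  have hb : Function.update φ p m b = φ b := Function.update_of_ne hpb _ _
  refine ⟨Function.update φ p m, upd h p m (by simp) (fun y hy _ e => hno y (by simpa using hy) e),
    ha, hb, ?_, ?_, ?_⟩
  · intro u hu
    refine Function.update_of_ne (fun e => ?_) _ _
    subst e
    exact hpb (hub u hu hpc).symm
  · apply card_lt_card
    rw [ssubset_iff_of_subset]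
    · refine ⟨p, by simp [hpv, hap, hpc], ?_⟩
      rw [hb]
      simp [hm]
    · intro x hx
      rw [hb] at hx
      simp only [mem_filter, mem_univ, true_and] at hx ⊢
      refine ⟨hx.1, hx.2.1, ?_⟩
      by_cases e : x = p
      · rw [e, hpc]
      · rw [← hx.2.2, Function.update_of_ne e]
  · apply card_le_card
    intro x hx
    rw [ha] at hx
    simp only [mem_filter, mem_univ, true_and] at hx ⊢
    refine ⟨hx.1, hx.2.1, ?_⟩
    by_cases e : x = p
    · subst e
      have := hx.2.2
      rw [Function.update_self] at this
      exact absurd this.symm hma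
    · rw [← hx.2.2, Function.update_of_ne e]

lemma claimA_aux (H : BK G k) {v a b : V} (hva : G.Adj v a) (hvb : G.Adj v b)
    (hab : ¬ G.Adj a b) (n : ℕ) : ∀ φ : V → Fin k, PC G {v} φ →
    (∀ u, G.Adj v u → φ u = φ a → u = a) → (∀ u, G.Adj v u → φ u = φ b → u = b) → φ a ≠ φ b →
    (univ.filter (fun x => x ≠ v ∧ G.Adj a x ∧ φ x = φ b)).card +
      (univ.filter (fun x => x ≠ v ∧ G.Adj b x ∧ φ x = φ a)).card = n → False := by
  induction n using Nat.strong_induction_on with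
  | _ n ih =>
    intro φ h hua hub hne hn
    have hba : ¬ G.Adj b a := fun e => hab e.symm
    have hA : ∀ p, p ≠ v → G.Adj a p → φ p = φ b → ∀ m, m ≠ φ b →
        ∃ u, u ≠ v ∧ G.Adj p u ∧ φ u = m := by
      intro p hpv hap hpc m hm
      by_contra hc
      push Not at hc
      obtain ⟨ψ, h1, h2, h3, h4, h5, h6⟩ := step h hub hab p hpv hap hpc hva.ne' m hm hc
      refine ih _ ?_ ψ h1 ?_ ?_ ?_ rfl
      · omega
      · intro u hu e
        rw [h4 u hu, h2] at e
        exact hua u hu e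
      · intro u hu e
        rw [h4 u hu, h3] at e
        exact hub u hu e
      · rwa [h2, h3]
    have hB : ∀ q, q ≠ v → G.Adj b q → φ q = φ a → ∀ m, m ≠ φ a →
        ∃ u, u ≠ v ∧ G.Adj q u ∧ φ u = m := by
      intro p hpv hap hpc m hm
      by_contra hc
      push Not at hc
      obtain ⟨ψ, h1, h2, h3, h4, h5, h6⟩ := step h hua hba p hpv hap hpc hvb.ne' m hm hc
      refine ih _ ?_ ψ h1 ?_ ?_ ?_ rfl
      · omega
      · intro u hu e
        rw [h4 u hu, h3] at e
        exact hua u hu e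
      · intro u hu e
        rw [h4 u hu, h2] at e
        exact hub u hu e
      · rwa [h2, h3]
    rcases le_total (univ.filter (fun x => x ≠ v ∧ G.Adj b x ∧ φ x = φ a)).card
      (univ.filter (fun x => x ≠ v ∧ G.Adj a x ∧ φ x = φ b)).card with hle | hle
    · exact core H h hva hvb hua hub hne hab hA hB hle
    · exact core H h hvb hva hub hua hne.symm hba hB hA hle

lemma claimA (H : BK G k) {v a b : V} {φ : V → Fin k} (h : PC G {v} φ)
    (hva : G.Adj v a) (hvb : G.Adj v b)
    (hua : ∀ u, G.Adj v u → φ u = φ a → u = a)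
    (hub : ∀ u, G.Adj v u → φ u = φ b → u = b)
    (hne : φ a ≠ φ b) : G.Adj a b := by
  by_contra hab
  exact claimA_aux H hva hvb hab _ φ h hua hub hne rfl

lemma struct (H : BK G k) {v : V} {φ : V → Fin k} (h : PC G {v} φ) :
    (N G v).card = k + 1 ∧ ∃ y1 y2, y1 ≠ y2 ∧ G.Adj v y1 ∧ G.Adj v y2 ∧ φ y1 = φ y2 ∧
      (∀ u u', G.Adj v u → G.Adj v u' → u ≠ y1 → u ≠ y2 → φ u' = φ u → u' = u) ∧
      (∀ x y, G.Adj v x → G.Adj v y → x ≠ y → x ≠ y1 → x ≠ y2 → y ≠ y1 → y ≠ y2 → G.Adj x y) := by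
  have hsee : ∀ m ∈ (univ : Finset (Fin k)), ∃ u ∈ N G v, φ u = m := fun m _ => by
    obtain ⟨u, h1, h2⟩ := seesHole H h m
    exact ⟨u, mem_N.2 h1, h2⟩
  have hdeg := H.hdeg v
  have hge : k ≤ (N G v).card := by
    have := cnt (N G v) φ univ ∅ (by simp) hsee (by simp)
    simpa using this
  have hvN : v ∉ N G v := fun e => (mem_N.1 e).ne rfl
  obtain ⟨y1, y2, hy, h1, h2, h12⟩ : ∃ y1 y2, y1 ≠ y2 ∧ G.Adj v y1 ∧ G.Adj v y2 ∧ φ y1 = φ y2 := by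
    by_contra hc
    push Not at hc
    have huniq : ∀ x, G.Adj v x → ∀ u, G.Adj v u → φ u = φ x → u = x := fun x hx u hu e => by
      by_contra hne
      exact hc u x hne hu hx e
    have := H.hcl (insert v (N G v)) (by
      intro x hx y hy hxy
      rcases mem_insert.1 hx with rfl | hx <;> rcases mem_insert.1 hy with rfl | hy
      · exact absurd rfl hxy
      · exact mem_N.1 hy
      · exact (mem_N.1 hx).symm
      · rw [mem_N] at hx hy
        exact claimA H h hx hy (huniq x hx) (huniq y hy) (hc x y hxy hx hy))
    rw [card_insert_of_notMem hvN] at this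
    omega
  have hc1 : k + 1 ≤ (N G v).card := by
    have := cnt (N G v) φ univ {φ y1} (by simp) hsee (by
      intro m hm
      rw [mem_singleton.1 hm]
      exact ⟨y1, mem_N.2 h1, y2, mem_N.2 h2, hy, rfl, h12.symm⟩)
    simpa using this
  have huniq : ∀ u u', G.Adj v u → G.Adj v u' → u ≠ y1 → u ≠ y2 → φ u' = φ u → u' = u := by
    intro u u' hu hu' hu1 hu2 hc
    by_contra hne
    by_cases hcc : φ u = φ y1
    · have := cnt ((N G v).erase u) φ univ {φ y1} (by simp) (by
        intro m hm
        obtain ⟨w, hw, hwc⟩ := hsee m hm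
        by_cases hwu : w = u
        · exact ⟨y1, mem_erase.2 ⟨hu1.symm, mem_N.2 h1⟩, by rw [← hwc, hwu, hcc]⟩
        · exact ⟨w, mem_erase.2 ⟨hwu, hw⟩, hwc⟩) (by
        intro m hm
        rw [mem_singleton.1 hm]
        exact ⟨y1, mem_erase.2 ⟨hu1.symm, mem_N.2 h1⟩, y2, mem_erase.2 ⟨hu2.symm, mem_N.2 h2⟩,
          hy, rfl, h12.symm⟩)
      rw [card_erase_of_mem (mem_N.2 hu)] at this
      simp at this
      omega
    · have := cnt (N G v) φ univ {φ y1, φ u} (by simp) hsee (by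
        intro m hm
        rcases mem_insert.1 hm with rfl | hm
        · exact ⟨y1, mem_N.2 h1, y2, mem_N.2 h2, hy, rfl, h12.symm⟩
        · rw [mem_singleton.1 hm]
          exact ⟨u', mem_N.2 hu', u, mem_N.2 hu, hne, hc, rfl⟩)
      rw [card_pair (fun e => hcc e.symm)] at this
      simp at this
      omega
  refine ⟨by omega, y1, y2, hy, h1, h2, h12, huniq, ?_⟩
  intro x y hx hy hxy x1 x2 y1' y2'
  exact claimA H h hx hy (fun u hu e => huniq x u hx hu x1 x2 e)
    (fun u hu e => huniq y u hy hu y1' y2' e) (fun e => hxy (huniq y x hy hx y1' y2' e))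

lemma deg_eq (H : BK G k) (v : V) : (N G v).card = k + 1 := by
  obtain ⟨φ, h⟩ := H.hcrit v
  exact (struct H h).1

lemma final (H : BK G k) (X S : Finset V) (d : Fin k)
    (h1 : ∀ ψ : V → Fin k, PC G X ψ → (∀ s ∈ S, ψ s = d) → ∀ s ∈ S, ∀ m, m ≠ d →
      ∃ u, u ∉ X ∧ G.Adj s u ∧ ψ u = m)
    (h3 : ∀ s ∈ S, ∀ z, z ∉ X → G.Adj s z → 4 ≤ (N G z ∩ S).card)
    (ψ : V → Fin k) (hψ : PC G X ψ) (hS : ∀ s ∈ S, ψ s = d) (hne : S.Nonempty) : False := by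
  obtain ⟨s, hs⟩ := hne
  have hk := H.hk
  obtain ⟨m, hmd, hm⟩ : ∃ m, m ≠ d ∧ ∀ u u', u ∉ X → u' ∉ X → G.Adj s u → G.Adj s u' →
      ψ u = m → ψ u' = m → u = u' := by
    by_contra hc
    push Not at hc
    have := cnt ((N G s) \ X) ψ (univ.erase d) (univ.erase d) (by simp)
      (fun m hm => by
        obtain ⟨u, hu1, hu2, hu3⟩ := h1 ψ hψ hS s hs m (ne_of_mem_erase hm)
        exact ⟨u, mem_sdiff.2 ⟨mem_N.2 hu2, hu1⟩, hu3⟩)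
      (fun m hm => by
        obtain ⟨u, u', hu1, hu2, hu3, hu4, hu5, hu6, hu7⟩ := hc m (ne_of_mem_erase hm)
        exact ⟨u, mem_sdiff.2 ⟨mem_N.2 hu3, hu1⟩, u', mem_sdiff.2 ⟨mem_N.2 hu4, hu2⟩, hu7, hu5, hu6⟩)
    rw [card_erase_of_mem (mem_univ _)] at this
    have h5 := H.hdeg s
    have h6 := card_le_card (sdiff_subset (s := N G s) (t := X))
    simp at this
    omega
  obtain ⟨z, hz1, hz2, hz3⟩ := h1 ψ hψ hS s hs m hmd
  obtain ⟨m', hm1, hm2, hm3⟩ : ∃ m', m' ≠ d ∧ m' ≠ m ∧ ∀ u, u ∉ X → G.Adj z u → ψ u ≠ m' := by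
    by_contra hc
    push Not at hc
    have := cnt ((N G z) \ S) ψ ((univ.erase d).erase m) ∅ (by simp)
      (fun m' hm => by
        simp only [mem_erase] at hm
        obtain ⟨u, hu1, hu2, hu3⟩ := hc m' hm.2.1 hm.1
        refine ⟨u, mem_sdiff.2 ⟨mem_N.2 hu2, fun e => hm.2.1 ?_⟩, hu3⟩
        rw [← hu3, hS u e]) (by simp)
    rw [card_erase_of_mem (by simp [hmd]), card_erase_of_mem (mem_univ _)] at this
    have h5 := H.hdeg z
    have h6 := card_sdiff_add_card_inter (N G z) S
    have h7 := h3 s hs z hz1 hz2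
    simp at this
    omega
  have hzS : ∀ s ∈ S, s ≠ z := fun s hs e => hmd (by rw [← hz3, ← e, hS s hs])
  obtain ⟨u, hu1, hu2, hu3⟩ := h1 (Function.update ψ z m')
    (upd hψ z m' (subset_insert _ _) (fun y hy _ e => hm3 y hy e))
    (fun s hs => by rw [Function.update_of_ne (hzS s hs), hS s hs]) s hs m hmd
  by_cases e : u = z
  · rw [e, Function.update_self] at hu3
    exact hm2 hu3
  · rw [Function.update_of_ne e] at hu3
    exact e (hm u z hu1 hz1 hu2 hz2 hu3 hz3)

end BKP5

set_option linter.unusedSectionVars false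
namespace BKP5
open Finset Classical
variable {V : Type*} [Fintype V] {G : SimpleGraph V} {k : ℕ}

lemma noT (H : BK G k) (R : Finset V) (hR : R.card = k - 1)
    (hcl : ∀ x ∈ R, ∀ y ∈ R, x ≠ y → G.Adj x y) (y t : V) (hy : y ∉ R) (ht : t ∉ R) (hyt : y ≠ t)
    (hyR : ∀ r ∈ R, G.Adj y r) (htR : ∀ r ∈ R, G.Adj t r) : False := by
  have hk := H.hk
  have : Nonempty V := ⟨y⟩
  have P5 := H.hP5
  -- two vertices complete to R are nonadjacent
  have hnon : ∀ x z, x ∉ R → z ∉ R → (∀ r ∈ R, G.Adj x r) → (∀ r ∈ R, G.Adj z r) →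
      ¬ G.Adj x z := by
    intro x z hx hz hxR hzR hxz
    have := H.hcl (insert x (insert z R)) (by
      intro u hu w hw huw
      simp only [mem_insert] at hu hw
      rcases hu with rfl | rfl | hu <;> rcases hw with rfl | rfl | hw
      · exact absurd rfl huw
      · exact hxz
      · exact hxR _ hw
      · exact hxz.symm
      · exact absurd rfl huw
      · exact hzR _ hw
      · exact (hxR _ hu).symm
      · exact (hzR _ hu).symm
      · exact hcl _ hu _ hw huw)
    rw [card_insert_of_notMem (by simp [hx, hxz.ne]), card_insert_of_notMem hz] at this
    omega
  have nyt : ¬ G.Adj y t := hnon y t hy ht hyR htR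
  obtain ⟨T, hT⟩ : ∃ T, T = insert y (insert t R) := ⟨_, rfl⟩
  have hTc : T.card = k + 1 := by
    rw [hT, card_insert_of_notMem (by simp [hy, hyt]), card_insert_of_notMem ht]
    omega
  have hRT : ∀ r ∈ R, r ∈ T := fun r hr => by simp [hT, hr]
  have hyT : y ∈ T := by simp [hT]
  have htT : t ∈ T := by simp [hT]
  have hTcase : ∀ x, x ∈ T → x ∈ R ∨ (x ∉ R ∧ (x = y ∨ x = t)) := by
    intro x hx
    simp only [hT, mem_insert] at hx
    tauto
  have hone : ∀ r ∈ R, ∃ s, N G r \ T = {s} := by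
    intro r hr
    rw [← card_eq_one]
    have h1 : N G r ∩ T = T.erase r := by
      ext x
      simp only [mem_inter, mem_N, mem_erase]
      constructor
      · rintro ⟨h1, h2⟩
        exact ⟨h1.ne', h2⟩
      · rintro ⟨h1, h2⟩
        refine ⟨?_, h2⟩
        rcases hTcase x h2 with h3 | ⟨_, rfl | rfl⟩
        · exact hcl r hr x h3 h1.symm
        · exact (hyR r hr).symm
        · exact (htR r hr).symm
    have h2 := card_sdiff_add_card_inter (N G r) T
    rw [h1, card_erase_of_mem (hRT r hr), hTc, deg_eq H] at h2
    omega
  choose! o ho using hone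
  have ho1 : ∀ r ∈ R, o r ∉ T ∧ G.Adj r (o r) := fun r hr => by
    have : o r ∈ N G r \ T := by rw [ho r hr]; simp
    rw [mem_sdiff, mem_N] at this
    exact ⟨this.2, this.1⟩
  have ho2 : ∀ r ∈ R, ∀ u, u ∉ T → G.Adj r u → u = o r := fun r hr u hu hru => by
    have : u ∈ N G r \ T := by rw [mem_sdiff, mem_N]; exact ⟨hru, hu⟩
    rw [ho r hr] at this
    simpa using this
  have ext : ∀ (ψ : V → Fin k) (m : Fin k), PC G T ψ → (∀ u, u ∉ T → G.Adj y u → ψ u ≠ m) →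
      (∀ u, u ∉ T → G.Adj t u → ψ u ≠ m) → ∃ d, d ≠ m ∧ ∀ r ∈ R, ψ (o r) = d := by
    intro ψ m hψ hym htm
    by_contra hc
    push Not at hc
    have hall := (Finset.all_card_le_biUnion_card_iff_exists_injective
      (fun r : {r // r ∈ R} => (univ : Finset (Fin k)) \ {m, ψ (o r.1)})).1 (by
        intro s
        rcases s.eq_empty_or_nonempty with rfl | ⟨r, hr⟩
        · simp
        have hs : s.card ≤ k - 1 := by
          have := card_le_univ s
          rw [Fintype.card_coe, hR] at this
          exact this
        by_cases hs2 : s.card ≤ k - 2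
        · refine hs2.trans (le_trans ?_ (card_le_card (subset_biUnion_of_mem _ hr)))
          have h1 := card_sdiff_add_card_inter (univ : Finset (Fin k)) {m, ψ (o r.1)}
          have h2 := card_le_card (inter_subset_right (s₁ := (univ : Finset (Fin k)))
            (s₂ := {m, ψ (o r.1)}))
          have h3 : ({m, ψ (o r.1)} : Finset (Fin k)).card ≤ 2 := card_le_two
          rw [card_univ, Fintype.card_fin] at h1
          omega
        · have hsu : s = univ := by
            apply eq_univ_of_card
            rw [Fintype.card_coe, hR]
            omega
          have h1 : (univ.erase m : Finset (Fin k)) ⊆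
              s.biUnion (fun r : {r // r ∈ R} => (univ : Finset (Fin k)) \ {m, ψ (o r.1)}) := by
            intro m' hm'
            have hm' := ne_of_mem_erase hm'
            obtain ⟨r, hr, hrm⟩ := hc m' hm'
            rw [mem_biUnion]
            exact ⟨⟨r, hr⟩, by rw [hsu]; simp, by simp [hm', hrm.symm]⟩
          have h2 := card_le_card h1
          rw [card_erase_of_mem (mem_univ _), card_univ, Fintype.card_fin] at h2
          omega)
    obtain ⟨f, hf, hfl⟩ := hall
    have hf1 : ∀ r, f r ≠ m := fun r e => by
      have := hfl r
      simp [e] at this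
    have hf2 : ∀ r, f r ≠ ψ (o r.1) := fun r e => by
      have := hfl r
      simp [e] at this
    let χ : V → Fin k := fun x => if hx : x ∈ R then f ⟨x, hx⟩ else
      if x = y ∨ x = t then m else ψ x
    have χR : ∀ x (hx : x ∈ R), χ x = f ⟨x, hx⟩ := fun x hx => dif_pos hx
    have χy : ∀ x, x ∉ R → x = y ∨ x = t → χ x = m := fun x hx e => by
      simp only [χ]
      rw [dif_neg hx, if_pos e]
    have χo : ∀ x, x ∉ T → χ x = ψ x := fun x hx => by
      simp only [χ]
      rw [dif_neg (fun e => hx (hRT x e)), if_neg]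
      rintro (rfl | rfl)
      · exact hx hyT
      · exact hx htT
    have c3 : ∀ x, x ∈ R ∨ (x ∉ R ∧ (x = y ∨ x = t)) ∨ x ∉ T := fun x => by
      by_cases hx : x ∈ T
      · rcases hTcase x hx with h | h <;> tauto
      · tauto
    have r1 : ∀ x, x ∈ R → ∀ w, (w ∉ R ∧ (w = y ∨ w = t)) → χ x ≠ χ w := by
      intro x hx w hw
      rw [χR x hx, χy w hw.1 hw.2]
      exact hf1 _
    have r2 : ∀ x, x ∈ R → ∀ w, w ∉ T → G.Adj x w → χ x ≠ χ w := by
      intro x hx w hw e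
      rw [χR x hx, χo w hw, ho2 x hx w hw e]
      exact hf2 _
    have r3 : ∀ x, (x ∉ R ∧ (x = y ∨ x = t)) → ∀ w, w ∉ T → G.Adj x w → χ x ≠ χ w := by
      intro x hx w hw e
      rw [χy x hx.1 hx.2, χo w hw]
      rcases hx.2 with rfl | rfl
      · exact (hym w hw e).symm
      · exact (htm w hw e).symm
    refine H.hncol χ ?_
    intro x w _ _ hxw
    rcases c3 x with hx | hx | hx <;> rcases c3 w with hw | hw | hw
    · rw [χR x hx, χR w hw]
      intro e
      have := hf e
      simp only [Subtype.mk.injEq] at this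
      exact hxw.ne this
    · exact r1 x hx w hw
    · exact r2 x hx w hw hxw
    · exact (r1 w hw x hx).symm
    · exfalso
      rcases hx.2 with rfl | rfl <;> rcases hw.2 with rfl | rfl
      · exact hxw.ne rfl
      · exact nyt hxw
      · exact nyt hxw.symm
      · exact hxw.ne rfl
    · exact r3 x hx w hw hxw
    · exact (r2 w hw x hx hxw.symm).symm
    · exact (r3 w hw x hx hxw.symm).symm
    · rw [χo x hx, χo w hw]
      exact hψ x w hx hw hxw
  have out2 : ∀ x, (∀ r ∈ R, G.Adj x r) → (N G x \ T).card ≤ 2 := by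
    intro x hx
    have h1 : R ⊆ N G x ∩ T := fun r hr => mem_inter.2 ⟨mem_N.2 (hx r hr), hRT r hr⟩
    have h2 := card_le_card h1
    have h3 := card_sdiff_add_card_inter (N G x) T
    have h4 := H.hdeg x
    omega
  have avail : ∀ (ψ : V → Fin k) (F : Finset (Fin k)), F.card ≤ 2 → ∃ m, m ∉ F ∧
      (∀ u, u ∉ T → G.Adj y u → ψ u ≠ m) ∧ (∀ u, u ∉ T → G.Adj t u → ψ u ≠ m) := by
    intro ψ F hF
    have h1 : (F ∪ ((N G y \ T).image ψ ∪ (N G t \ T).image ψ)).card < (univ : Finset (Fin k)).card := by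
      have i1 := card_union_le F ((N G y \ T).image ψ ∪ (N G t \ T).image ψ)
      have i2 := card_union_le ((N G y \ T).image ψ) ((N G t \ T).image ψ)
      have i3 := card_image_le (f := ψ) (s := N G y \ T)
      have i4 := card_image_le (f := ψ) (s := N G t \ T)
      have i5 := out2 y hyR
      have i6 := out2 t htR
      rw [card_univ, Fintype.card_fin]
      omega
    obtain ⟨m, -, hm⟩ := exists_mem_notMem_of_card_lt_card h1
    simp only [mem_union, mem_image, mem_sdiff, mem_N, not_or, not_exists, not_and, and_imp] at hm
    exact ⟨m, hm.1, fun u hu e => hm.2.1 u e hu, fun u hu e => hm.2.2 u e hu⟩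
  obtain ⟨r0, hr0⟩ : R.Nonempty := by
    rw [← card_pos]
    omega
  obtain ⟨φ, hφ0⟩ := H.hcrit r0
  have hφ : PC G T φ := fun x y hx hy => hφ0 x y
    (by simp only [mem_singleton]; rintro rfl; exact hx (hRT _ hr0))
    (by simp only [mem_singleton]; rintro rfl; exact hy (hRT _ hr0))
  by_cases hall : ∀ r ∈ R, o r = o r0
  · obtain ⟨s, hs⟩ : ∃ s, s = o r0 := ⟨_, rfl⟩
    have hsR : ∀ r ∈ R, G.Adj s r := fun r hr => by
      have := (ho1 r hr).2.symm
      rwa [hall r hr, ← hs] at this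
    have hsT : s ∉ T := hs ▸ (ho1 r0 hr0).1
    have hsR' : s ∉ R := fun e => hsT (hRT s e)
    obtain ⟨m, hm1, hm2, hm3⟩ := avail φ ((N G s \ T).image φ) (card_image_le.trans (out2 s hsR))
    simp only [mem_image, mem_sdiff, mem_N, not_exists, not_and, and_imp] at hm1
    have nys := hnon y s hy hsR' hyR hsR
    have nts := hnon t s ht hsR' htR hsR
    obtain ⟨d, hd1, hd2⟩ := ext (Function.update φ s m) m
      (upd hφ s m (subset_insert _ _) (fun u hu _ e => hm1 u e hu))
      (fun u hu e => by
        have hus : u ≠ s := fun h => nys (by rw [← h]; exact e)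
        rw [Function.update_of_ne hus]
        exact hm2 u hu e)
      (fun u hu e => by
        have hus : u ≠ s := fun h => nts (by rw [← h]; exact e)
        rw [Function.update_of_ne hus]
        exact hm3 u hu e)
    have := hd2 r0 hr0
    rw [← hs, Function.update_self] at this
    exact hd1 this.symm
  · push Not at hall
    obtain ⟨r1, hr1, h01⟩ := hall
    obtain ⟨m, -, hm2, hm3⟩ := avail φ ∅ (by simp)
    obtain ⟨d, -, hd⟩ := ext φ m hφ hm2 hm3
    obtain ⟨S, hS⟩ : ∃ S, S = R.image o := ⟨_, rfl⟩
    have hSm : ∀ s, s ∈ S ↔ ∃ r ∈ R, o r = s := fun s => by rw [hS, mem_image]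
    have hφS : ∀ s ∈ S, φ s = d := fun s hs => by
      obtain ⟨r, hr, rfl⟩ := (hSm s).1 hs
      exact hd r hr
    have hST : ∀ s ∈ S, s ∉ T := fun s hs => by
      obtain ⟨r, hr, rfl⟩ := (hSm s).1 hs
      exact (ho1 r hr).1
    have h1 : ∀ ψ : V → Fin k, PC G T ψ → (∀ s ∈ S, ψ s = d) → ∀ s ∈ S, ∀ m, m ≠ d →
        ∃ u, u ∉ T ∧ G.Adj s u ∧ ψ u = m := by
      intro ψ hψ hψS s hs m hm
      by_contra hc
      push Not at hc
      obtain ⟨m0, -, hm2, hm3⟩ := avail (Function.update ψ s m) ∅ (by simp)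
      obtain ⟨d', -, hd'⟩ := ext (Function.update ψ s m) m0
        (upd hψ s m (subset_insert _ _) (fun u hu _ e => hc u hu e)) hm2 hm3
      have hdm : d' = m := by
        obtain ⟨r, hr, rfl⟩ := (hSm s).1 hs
        have := hd' r hr
        rw [Function.update_self] at this
        exact this.symm
      obtain ⟨r, hr, hrs⟩ : ∃ r ∈ R, o r ≠ s := by
        by_cases e : o r0 = s
        · exact ⟨r1, hr1, fun f => h01 (f.trans e.symm)⟩
        · exact ⟨r0, hr0, e⟩
      have := hd' r hr
      rw [Function.update_of_ne hrs, hψS _ ((hSm _).2 ⟨r, hr, rfl⟩), hdm] at this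
      exact hm this.symm
    have hcard : 4 ≤ S.card := by
      have : R.card ≤ 2 * (R.image o).card := by
        apply card_le_mul_card_image
        intro s hs
        rw [← hS] at hs
        have i1 := cnt (N G s \ T) φ (univ.erase d) ∅ (by simp) (fun m hm => by
          obtain ⟨u, hu1, hu2, hu3⟩ := h1 φ hφ hφS s hs m (ne_of_mem_erase hm)
          exact ⟨u, mem_sdiff.2 ⟨mem_N.2 hu2, hu1⟩, hu3⟩) (by simp)
        have i2 := card_sdiff_add_card_inter (N G s) T
        have i3 := H.hdeg s
        have i4 : (R.filter (fun r => o r = s)) ⊆ N G s ∩ T := by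
          intro r hr
          obtain ⟨hr2, hr3⟩ := mem_filter.1 hr
          exact mem_inter.2 ⟨mem_N.2 (hr3 ▸ (ho1 r hr2).2.symm), hRT r hr2⟩
        have i5 := card_le_card i4
        rw [card_erase_of_mem (mem_univ _), card_univ, Fintype.card_fin] at i1
        simp at i1
        omega
      rw [← hS] at this
      omega
    refine final H T S d h1 ?_ φ hφ hφS ⟨o r0, (hSm _).2 ⟨r0, hr0, rfl⟩⟩
    intro s hs z hz hsz
    refine hcard.trans (card_le_card ?_)
    intro s' hs'
    refine mem_inter.2 ⟨mem_N.2 ?_, hs'⟩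
    by_cases hss : s = s'
    · exact hss ▸ hsz.symm
    by_contra hc
    have hzR : ∀ r ∈ R, ¬ G.Adj z r := fun r hr e => by
      have hzS : z ∈ S := (hSm z).2 ⟨r, hr, (ho2 r hr z hz e.symm).symm⟩
      exact hφ s z (hST s hs) hz hsz ((hφS s hs).trans (hφS z hzS).symm)
    have hsT := hST s hs
    have hsT' := hST s' hs'
    have hsc := hφS s hs
    have hsc' := hφS s' hs'
    obtain ⟨r, hr, hrs⟩ := (hSm s).1 hs
    obtain ⟨r', hr', hrs'⟩ := (hSm s').1 hs'
    have hrr : r ≠ r' := fun e => hss (by rw [← hrs, ← hrs', e])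
    exact P5 z s r r' s' hsz.symm (hrs ▸ (ho1 r hr).2.symm) (hcl r hr r' hr' hrr)
      (hrs' ▸ (ho1 r' hr').2) (hzR r hr) (hzR r' hr') hc
      (fun e => hss ((ho2 r' hr' s hsT e.symm).trans hrs'))
      (fun e => hφ s s' hsT hsT' e (hsc.trans hsc'.symm))
      (fun e => hss ((ho2 r hr s' hsT' e).trans hrs).symm)

end BKP5

set_option linter.unusedSectionVars false
namespace BKP5
open Finset Classical
variable {V : Type*} [Fintype V] {G : SimpleGraph V} {k : ℕ}

lemma outK (H : BK G k) (K : Finset V) (hK : K.card = k)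
    (hcl : ∀ x ∈ K, ∀ y ∈ K, x ≠ y → G.Adj x y) (v : V) (hv : v ∈ K) :
    (N G v \ K).card = 2 := by
  have hk := H.hk
  have h1 : N G v ∩ K = K.erase v := by
    ext x
    simp only [mem_inter, mem_N, mem_erase]
    exact ⟨fun h => ⟨h.1.ne', h.2⟩, fun h => ⟨hcl v hv x h.2 h.1.symm, h.2⟩⟩
  have h2 := card_sdiff_add_card_inter (N G v) K
  rw [h1, card_erase_of_mem hv, hK, deg_eq H] at h2
  omega

lemma lemIII (H : BK G k) (K : Finset V) (hK : K.card = k)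
    (hcl : ∀ x ∈ K, ∀ y ∈ K, x ≠ y → G.Adj x y) (v : V) (hv : v ∈ K) (φ : V → Fin k)
    (h : PC G {v} φ) : ∃ c, (∀ y, y ∉ K → G.Adj v y → φ y = c) ∧
      (∀ x ∈ K, x ≠ v → φ x ≠ c) ∧
      (∀ x ∈ K, x ≠ v → ∀ u, G.Adj v u → φ u = φ x → u = x) := by
  have h2 := outK H K hK hcl v hv
  obtain ⟨-, y1, y2, hne, hv1, hv2, h12, huniq, hclq⟩ := struct H h
  have key : ∀ y1 y2, y1 ≠ y2 → G.Adj v y1 → G.Adj v y2 → φ y1 = φ y2 →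
      (∀ x y, G.Adj v x → G.Adj v y → x ≠ y → x ≠ y1 → x ≠ y2 → y ≠ y1 → y ≠ y2 → G.Adj x y) →
      y1 ∉ K := by
    intro y1 y2 hne hv1 hv2 h12 hclq hy1
    have hy2 : y2 ∉ K := fun hy2 => h y1 y2 (by simpa using hv1.ne') (by simpa using hv2.ne')
      (hcl y1 hy1 y2 hy2 hne) h12
    obtain ⟨y, hy, hyy⟩ := exists_mem_ne (s := N G v \ K) (by omega) y2
    rw [mem_sdiff, mem_N] at hy
    have hy1' : y ≠ y1 := fun e => hy.2 (e ▸ hy1)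
    refine noT H (K.erase y1) (by rw [card_erase_of_mem hy1, hK])
      (fun a ha b hb => hcl a (mem_of_mem_erase ha) b (mem_of_mem_erase hb)) y y1
      (fun e => hy.2 (mem_of_mem_erase e)) (notMem_erase _ _) hy1' ?_ ?_
    · intro r hr
      obtain ⟨hr1, hr2⟩ := mem_erase.1 hr
      by_cases hrv : r = v
      · exact hrv ▸ hy.1.symm
      · exact hclq y r hy.1 (hcl v hv r hr2 (Ne.symm hrv)) (fun e => hy.2 (e ▸ hr2)) hy1' hyy hr1
          (fun e => hy2 (e ▸ hr2))
    · intro r hr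
      obtain ⟨hr1, hr2⟩ := mem_erase.1 hr
      exact hcl y1 hy1 r hr2 hr1.symm
  have n1 := key y1 y2 hne hv1 hv2 h12 hclq
  have n2 := key y2 y1 hne.symm hv2 hv1 h12.symm
    (fun x y a b c d e f g => hclq x y a b c e d g f)
  have hset : ({y1, y2} : Finset V) = N G v \ K := by
    apply eq_of_subset_of_card_le
    · intro x hx
      simp only [mem_insert, mem_singleton] at hx
      rw [mem_sdiff, mem_N]
      rcases hx with rfl | rfl
      · exact ⟨hv1, n1⟩
      · exact ⟨hv2, n2⟩
    · rw [h2, card_pair hne]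
  have hu : ∀ x ∈ K, x ≠ v → ∀ u, G.Adj v u → φ u = φ x → u = x := fun x hx hxv u hu e =>
    huniq x u (hcl v hv x hx hxv.symm) hu (fun e => n1 (e ▸ hx)) (fun e => n2 (e ▸ hx)) e
  refine ⟨φ y1, ?_, ?_, hu⟩
  · intro y hy hvy
    have : y ∈ ({y1, y2} : Finset V) := by
      rw [hset, mem_sdiff, mem_N]
      exact ⟨hvy, hy⟩
    simp only [mem_insert, mem_singleton] at this
    rcases this with rfl | rfl
    · rfl
    · exact h12.symm
  · intro x hx hxv e
    have := hu x hx hxv y1 hv1 e.symm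
    exact n1 (this ▸ hx)

lemma noK (H : BK G k) (K : Finset V) (hK : K.card = k)
    (hcl : ∀ x ∈ K, ∀ y ∈ K, x ≠ y → G.Adj x y) : False := by
  have hk := H.hk
  obtain ⟨v, hv⟩ : K.Nonempty := by
    rw [← card_pos]
    omega
  obtain ⟨φ, h⟩ := H.hcrit v
  obtain ⟨c, hc1, hc2, hc3⟩ := lemIII H K hK hcl v hv φ h
  have houter : ∀ x ∈ K, ∀ y, y ∉ K → G.Adj x y → φ y = c := by
    intro x hx y hy hxy
    by_cases hxv : x = v
    · exact hc1 y hy (hxv ▸ hxy)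
    have hm := moveHole h (hc3 x hx hxv)
    obtain ⟨c', hc1', hc2', hc3'⟩ := lemIII H K hK hcl x hx _ hm
    obtain ⟨u, hu1, hu2⟩ := seesHole H hm c
    have huK : u ∉ K := by
      intro hu
      by_cases huv : u = v
      · rw [huv, Function.update_self] at hu2
        exact hc2 x hx hxv hu2
      · rw [Function.update_of_ne huv] at hu2
        exact hc2 u hu huv hu2
    have e1 := hc1' u huK hu1
    have e2 := hc1' y hy hxy
    rw [hu2] at e1
    have hyv : y ≠ v := fun e => hy (e ▸ hv)
    rw [Function.update_of_ne hyv] at e2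
    rw [e1, e2]
  have hφK : PC G K φ := fun x y hx hy => h x y
    (by simp only [mem_singleton]; rintro rfl; exact hx hv)
    (by simp only [mem_singleton]; rintro rfl; exact hy hv)
  obtain ⟨S, hSm⟩ : ∃ S : Finset V, ∀ s, s ∈ S ↔ s ∉ K ∧ ∃ x ∈ K, G.Adj x s :=
    ⟨univ.filter (fun s => s ∉ K ∧ ∃ x ∈ K, G.Adj x s), fun s => by simp⟩
  have hφS : ∀ s ∈ S, φ s = c := fun s hs => by
    obtain ⟨h1, x, hx, h2⟩ := (hSm s).1 hs
    exact houter x hx s h1 h2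
  have h1 : ∀ ψ : V → Fin k, PC G K ψ → (∀ s ∈ S, ψ s = c) → ∀ s ∈ S, ∀ m, m ≠ c →
      ∃ u, u ∉ K ∧ G.Adj s u ∧ ψ u = m := by
    intro ψ hψ hψS s hs m hm
    by_contra hcon
    push Not at hcon
    obtain ⟨hsK, w, hw, hws⟩ := (hSm s).1 hs
    obtain ⟨t, ht, hst⟩ : ∃ t ∈ K, ¬ G.Adj s t := by
      by_contra hall
      push Not at hall
      have := H.hcl (insert s K) (by
        intro a ha b hb hab
        rw [mem_insert] at ha hb
        rcases ha with rfl | ha <;> rcases hb with rfl | hb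
        · exact absurd rfl hab
        · exact hall b hb
        · exact (hall a ha).symm
        · exact hcl a ha b hb hab)
      rw [card_insert_of_notMem hsK] at this
      omega
    have htw : t ≠ w := fun e => hst (e ▸ hws.symm)
    obtain ⟨f, hfi, hfm⟩ : ∃ f : V → Fin k,
        (∀ x y, x ∈ K → y ∈ K → x ≠ w → y ≠ w → f x = f y → x = y) ∧
        (∀ x, x ∈ K → x ≠ w → f x ≠ c ∧ (f x = m → x = t)) := by
      have hA : ((K.erase w).erase t).card = k - 1 - 1 := by
        rw [card_erase_of_mem (mem_erase.2 ⟨htw, ht⟩), card_erase_of_mem hw, hK]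
      have hB : (((univ : Finset (Fin k)).erase c).erase m).card = k - 1 - 1 := by
        rw [card_erase_of_mem (mem_erase.2 ⟨hm, mem_univ _⟩), card_erase_of_mem (mem_univ _),
          card_univ, Fintype.card_fin]
      let e := equivOfCardEq (hA.trans hB.symm)
      have hep : ∀ x, (e x).1 ≠ m ∧ (e x).1 ≠ c := fun x => by
        have := (e x).2
        rw [mem_erase, mem_erase] at this
        exact ⟨this.1, this.2.1⟩
      have hmem : ∀ x, x ∈ K → x ≠ w → x ≠ t → x ∈ (K.erase w).erase t := fun x a b d =>
        mem_erase.2 ⟨d, mem_erase.2 ⟨b, a⟩⟩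
      let f : V → Fin k := fun x => if hx : x ∈ (K.erase w).erase t then (e ⟨x, hx⟩).1 else m
      have f1 : ∀ x (hx : x ∈ (K.erase w).erase t), f x = (e ⟨x, hx⟩).1 := fun x hx => dif_pos hx
      have f2 : f t = m := dif_neg (notMem_erase _ _)
      refine ⟨f, ?_, ?_⟩
      · intro x y hx hy hxw hyw hxy
        by_cases hxt : x = t <;> by_cases hyt : y = t
        · rw [hxt, hyt]
        · rw [hxt, f2, f1 y (hmem y hy hyw hyt)] at hxy
          exact absurd hxy.symm (hep _).1
        · rw [hyt, f2, f1 x (hmem x hx hxw hxt)] at hxy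
          exact absurd hxy (hep _).1
        · rw [f1 x (hmem x hx hxw hxt), f1 y (hmem y hy hyw hyt)] at hxy
          have := e.injective (Subtype.ext hxy)
          simpa using this
      · intro x hx hxw
        by_cases hxt : x = t
        · rw [hxt, f2]
          exact ⟨hm, fun _ => rfl⟩
        · rw [f1 x (hmem x hx hxw hxt)]
          exact ⟨(hep _).2, fun e => absurd e (hep _).1⟩
    let χ : V → Fin k := fun x => if x ∈ K then f x else if x = s then m else ψ x
    have χK : ∀ x, x ∈ K → χ x = f x := fun x hx => if_pos hx
    have χs : χ s = m := by
      simp only [χ]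
      rw [if_neg hsK]
      simp
    have χo : ∀ x, x ∉ K → x ≠ s → χ x = ψ x := fun x hx hxs => by
      simp only [χ]
      rw [if_neg hx, if_neg hxs]
    have r1 : ∀ x, x ∈ K → x ≠ w → ∀ u, u ∉ K → G.Adj x u → χ x ≠ χ u := by
      intro x hx hxw u hu hxu
      rw [χK x hx]
      by_cases hus : u = s
      · rw [hus, χs]
        intro e
        have := (hfm x hx hxw).2 e
        rw [hus, this] at hxu
        exact hst hxu.symm
      · rw [χo u hu hus, hψS u ((hSm u).2 ⟨hu, x, hx, hxu⟩)]
        exact (hfm x hx hxw).1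
    have hχ : PC G {w} χ := by
      intro x u hx hu hxu
      rw [mem_singleton] at hx hu
      by_cases hxK : x ∈ K <;> by_cases huK : u ∈ K
      · rw [χK x hxK, χK u huK]
        exact fun e => hxu.ne (hfi x u hxK huK hx hu e)
      · exact r1 x hxK hx u huK hxu
      · exact (r1 u huK hu x hxK hxu.symm).symm
      · by_cases hxs : x = s <;> by_cases hus : u = s
        · exact absurd (hxs.trans hus.symm) hxu.ne
        · rw [hxs, χs, χo u huK hus]
          exact (hcon u huK (hxs ▸ hxu)).symm
        · rw [hus, χs, χo x hxK hxs]
          exact hcon x hxK (hus ▸ hxu.symm)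
        · rw [χo x hxK hxs, χo u huK hus]
          exact hψ x u hxK huK hxu
    obtain ⟨c', hc', -, -⟩ := lemIII H K hK hcl w hw χ hχ
    obtain ⟨y, hy, hys⟩ := exists_mem_ne (s := N G w \ K)
      (by rw [outK H K hK hcl w hw]; omega) s
    rw [mem_sdiff, mem_N] at hy
    have e1 := hc' s hsK hws
    have e2 := hc' y hy.2 hy.1
    rw [χs] at e1
    rw [χo y hy.2 hys, hψS y ((hSm y).2 ⟨hy.2, w, hw, hy.1⟩)] at e2
    exact hm (e1.trans e2.symm)
  have hin : ∀ s ∈ S, (N G s ∩ K).card ≤ 2 := by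
    intro s hs
    have i1 := cnt (N G s \ K) φ (univ.erase c) ∅ (by simp) (fun m hm => by
      obtain ⟨u, hu1, hu2, hu3⟩ := h1 φ hφK hφS s hs m (ne_of_mem_erase hm)
      exact ⟨u, mem_sdiff.2 ⟨mem_N.2 hu2, hu1⟩, hu3⟩) (by simp)
    have i2 := card_sdiff_add_card_inter (N G s) K
    have i3 := H.hdeg s
    rw [card_erase_of_mem (mem_univ _), card_univ, Fintype.card_fin] at i1
    simp only [card_empty] at i1
    omega
  have hne : S.Nonempty := by
    obtain ⟨y, hy⟩ : (N G v \ K).Nonempty := by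
      rw [← card_pos, outK H K hK hcl v hv]
      omega
    rw [mem_sdiff, mem_N] at hy
    exact ⟨y, (hSm y).2 ⟨hy.2, v, hv, hy.1⟩⟩
  refine final H K S c h1 ?_ φ hφK hφS hne
  intro s hs z hz hsz
  obtain ⟨hsK, x1, hx1, hx1s⟩ := (hSm s).1 hs
  have hzS : z ∉ S := fun e => hφK s z hsK hz hsz ((hφS s hs).trans (hφS z e).symm)
  have hzK : ∀ x ∈ K, ¬ G.Adj z x := fun x hx e => hzS ((hSm z).2 ⟨hz, x, hx, e.symm⟩)
  have hg : ∀ x ∈ K \ N G s, ∃ y, y ∉ K ∧ G.Adj x y ∧ ¬ G.Adj x1 y := by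
    intro x hx
    rw [mem_sdiff, mem_N] at hx
    by_contra hcon
    push Not at hcon
    have hsub : N G x \ K ⊆ N G x1 \ K := by
      intro y hy
      rw [mem_sdiff, mem_N] at hy ⊢
      exact ⟨hcon y hy.2 hy.1, hy.2⟩
    have heq := eq_of_subset_of_card_le hsub
      (by rw [outK H K hK hcl x hx.1, outK H K hK hcl x1 hx1])
    have : s ∈ N G x \ K := by
      rw [heq, mem_sdiff, mem_N]
      exact ⟨hx1s, hsK⟩
    rw [mem_sdiff, mem_N] at this
    exact hx.2 this.1.symm
  choose! g hg1 hg2 hg3 using hg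
  have hgS : ∀ x ∈ K \ N G s, g x ∈ S := fun x hx =>
    (hSm _).2 ⟨hg1 x hx, x, (mem_sdiff.1 hx).1, hg2 x hx⟩
  have hgz : ∀ x ∈ K \ N G s, G.Adj z (g x) := by
    intro x hx
    have hx' := hx
    rw [mem_sdiff, mem_N] at hx'
    by_contra hc
    exact H.hP5 z s x1 x (g x) hsz.symm hx1s.symm
      (hcl x1 hx1 x hx'.1 (fun e => hx'.2 (e ▸ hx1s.symm))) (hg2 x hx) (hzK x1 hx1) (hzK x hx'.1)
      hc hx'.2 (fun e => hφK s (g x) hsK (hg1 x hx) e ((hφS s hs).trans (hφS _ (hgS x hx)).symm))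
      (hg3 x hx)
  have hD : k - 2 ≤ (K \ N G s).card := by
    have i1 := card_sdiff_add_card_inter K (N G s)
    have i2 := hin s hs
    rw [inter_comm] at i2
    omega
  have him : (K \ N G s).card ≤ 2 * ((K \ N G s).image g).card := by
    apply card_le_mul_card_image
    intro y hy
    obtain ⟨x, hx, rfl⟩ := mem_image.1 hy
    refine le_trans (card_le_card ?_) (hin (g x) (hgS x hx))
    intro x' hx'
    obtain ⟨a, b⟩ := mem_filter.1 hx'
    exact mem_inter.2 ⟨mem_N.2 (b ▸ (hg2 x' a).symm), (mem_sdiff.1 a).1⟩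
  have hsub : insert s ((K \ N G s).image g) ⊆ N G z ∩ S := by
    intro y hy
    rw [mem_insert, mem_image] at hy
    rw [mem_inter, mem_N]
    rcases hy with rfl | ⟨x, hx, rfl⟩
    · exact ⟨hsz.symm, hs⟩
    · exact ⟨hgz x hx, hgS x hx⟩
  have hcard := card_le_card hsub
  rw [card_insert_of_notMem (by
    rw [mem_image]
    rintro ⟨x, hx, e⟩
    exact hg3 x hx (e ▸ hx1s))] at hcard
  omega

lemma noBK (H : BK G k) : False := by
  have hk := H.hk
  by_cases hV : Nonempty V
  · obtain ⟨v⟩ := hV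
    obtain ⟨φ, h⟩ := H.hcrit v
    obtain ⟨hd, y1, y2, hne, hv1, hv2, h12, huniq, hclq⟩ := struct H h
    refine noK H (insert v (((N G v).erase y1).erase y2)) ?_ ?_
    · rw [card_insert_of_notMem (by simp [mem_N]),
        card_erase_of_mem (mem_erase.2 ⟨hne.symm, mem_N.2 hv2⟩), card_erase_of_mem (mem_N.2 hv1), hd]
      omega
    · intro x hx y hy hxy
      simp only [mem_insert, mem_erase, mem_N] at hx hy
      rcases hx with rfl | hx <;> rcases hy with rfl | hy
      · exact absurd rfl hxy
      · exact hy.2.2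
      · exact hx.2.2.symm
      · exact hclq x y hx.2.2 hy.2.2 hxy hx.2.1 hx.1 hy.2.1 hy.1
  · exact H.hncol (fun _ => ⟨0, by omega⟩) (fun x => absurd ⟨x⟩ hV)

universe u

lemma mainInd (k : ℕ) (hk : 8 ≤ k) (n : ℕ) : ∀ (V : Type u) [Fintype V] (G : SimpleGraph V),
    Fintype.card V = n → (∀ v, (N G v).card ≤ k + 1) →
    (∀ a b c d e, G.Adj a b → G.Adj b c → G.Adj c d → G.Adj d e →
    ¬ G.Adj a c → ¬ G.Adj a d → ¬ G.Adj a e → ¬ G.Adj b d → ¬ G.Adj b e → ¬ G.Adj c e → False) →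
    (∀ s : Finset V, (∀ x ∈ s, ∀ y ∈ s, x ≠ y → G.Adj x y) → s.card ≤ k) →
    ∃ φ : V → Fin k, PC G ∅ φ := by
  induction n with
  | zero =>
    intro V _ G h0 _ _ _
    have : IsEmpty V := Fintype.card_eq_zero_iff.1 h0
    exact ⟨fun x => isEmptyElim x, fun x => isEmptyElim x⟩
  | succ n ih =>
    intro V _ G hn hdeg hP5 hcl
    by_contra hcon
    push Not at hcon
    refine noBK (G := G) (k := k) ⟨hk, hdeg, hP5, hcon, ?_, hcl⟩
    intro v
    obtain ⟨φ, hφ⟩ := ih {x : V // x ≠ v} (G.comap Subtype.val)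
      (by rw [Fintype.card_subtype_compl, hn, Fintype.card_unique]; rfl)
      (fun x => by
        refine le_trans ?_ (hdeg x.1)
        rw [← card_map (Function.Embedding.subtype _)]
        apply card_le_card
        intro y hy
        obtain ⟨z, hz, rfl⟩ := mem_map.1 hy
        rw [mem_N] at hz
        have hz2 : G.Adj x.1 z.1 := hz
        exact mem_N.2 hz2)
      (fun a b c d e => hP5 a.1 b.1 c.1 d.1 e.1)
      (fun s hs => by
        rw [← card_map (Function.Embedding.subtype _)]
        apply hcl
        intro x hx y hy hxy
        obtain ⟨x', hx', rfl⟩ := mem_map.1 hx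
        obtain ⟨y', hy', rfl⟩ := mem_map.1 hy
        exact hs x' hx' y' hy' (fun e => hxy (by rw [e])))
    refine ⟨fun x => if hx : x ≠ v then φ ⟨x, hx⟩ else ⟨0, by omega⟩, ?_⟩
    intro x y hx hy hxy
    rw [mem_singleton] at hx hy
    simp only [ne_eq, hx, hy, not_false_eq_true, dite_true]
    exact hφ ⟨x, hx⟩ ⟨y, hy⟩ (by simp) (by simp) hxy

end BKP5

theorem borodin_kostochka_P5_free
    {V : Type*} [Fintype V]
    (G : SimpleGraph V) [DecidableRel G.Adj]
    (hΔ : 9 ≤ G.maxDegree)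
    (hfree : ¬ Nonempty (pathGraph 5 ↪g G)) :
    G.chromaticNumber ≤ (↑(max (G.maxDegree - 1) G.cliqueNum) : ℕ∞) := by
  obtain ⟨φ, hφ⟩ := BKP5.mainInd (max (G.maxDegree - 1) G.cliqueNum)
    (le_trans (by omega) (le_max_left _ _)) _ V G rfl
    (by
      intro v
      have h1 : (BKP5.N G v).card = G.degree v := by
        rw [← G.card_neighborFinset_eq_degree v]
        congr 1
        ext x
        rw [BKP5.mem_N, mem_neighborFinset]
      have h2 := G.degree_le_maxDegree v
      have h3 := le_max_left (G.maxDegree - 1) G.cliqueNum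
      omega)
    (by
      intro a b c d e ab bc cd de ac ad ae bd be ce
      apply hfree
      have key : ∀ i j : Fin 5, G.Adj (![a, b, c, d, e] i) (![a, b, c, d, e] j) ↔
          (pathGraph 5).Adj i j := by
        intro i j
        rw [pathGraph_adj]
        fin_cases i <;> fin_cases j <;> simp [ab, bc, cd, de, ac, ad, ae, bd, be, ce, G.adj_comm]
      refine ⟨⟨⟨![a, b, c, d, e], ?_⟩, fun {i j} => key i j⟩⟩
      intro i j hij
      have hk2 : ∀ l, (pathGraph 5).Adj i l ↔ (pathGraph 5).Adj j l := fun l => by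
        rw [← key, ← key, hij]
      simp only [pathGraph_adj] at hk2
      clear hij
      revert hk2
      revert i j
      decide)
    (by
      intro s hs
      have hq : G.IsClique s := fun x hx y hy hxy => hs x hx y hy hxy
      exact le_trans hq.card_le_cliqueNum (le_max_right _ _))
  exact Colorable.chromaticNumber_le ⟨Coloring.mk φ (fun {x y} h => hφ x y (by simp) (by simp) h)⟩
end

section
/- Let G be a finite simple graph with maximum degree Δ(G) ≥ 9 that is (K2 ∪ 2K1)-free, i.e., G contains no induced subgraph isomorphic to the disjoint union of an edge and two isolated vertices. Then χ(G) ≤ max{Δ(G) − 1, ω(G)}. -/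
open SimpleGraph

/-- `K2 ∪ 2K1`: the graph on four vertices whose only edge is `01`. -/
def K2Union2K1 : SimpleGraph (Fin 4) :=
  SimpleGraph.fromRel (fun a b => a = 0 ∧ b = 1)


section BK
set_option linter.unusedSectionVars false
variable {V : Type*} [Fintype V] [DecidableEq V] {H : SimpleGraph V}

/-- `A` can be partitioned into at most `#A - k` cliques of `H`. -/
def Sav (H : SimpleGraph V) (A : Finset V) (k : ℕ) : Prop :=
  ∃ f : V → V, (∀ x ∈ A, f x ∈ A) ∧ (∀ x ∈ A, ∀ y ∈ A, f x = f y → x = y ∨ H.Adj x y) ∧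
    (A.image f).card + k ≤ A.card

lemma Sav.le {A : Finset V} {k l : ℕ} (h : Sav H A k) (hl : l ≤ k) : Sav H A l := by
  obtain ⟨f, h1, h2, h3⟩ := h
  exact ⟨f, h1, h2, by omega⟩

lemma sav_zero (A : Finset V) : Sav H A 0 :=
  ⟨id, fun x hx => hx, fun x _ y _ h => Or.inl h, by simp⟩

lemma Sav.union {A B : Finset V} {k l : ℕ} (hA : Sav H A k) (hB : Sav H B l)
    (hd : Disjoint A B) : Sav H (A ∪ B) (k + l) := by
  obtain ⟨f, f1, f2, f3⟩ := hA
  obtain ⟨g, g1, g2, g3⟩ := hB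
  have hd' : ∀ x, x ∈ A → x ∈ B → False := fun x h1 h2 => Finset.disjoint_left.mp hd h1 h2
  refine ⟨fun v => if v ∈ A then f v else g v, ?_, ?_, ?_⟩
  · intro x hx
    grind
  · intro x hx y hy h
    simp only [Finset.mem_union] at hx hy
    by_cases hxA : x ∈ A <;> by_cases hyA : y ∈ A <;> simp only [hxA, hyA, if_true, if_false] at h
    · exact f2 x hxA y hyA h
    · exact (hd' _ (f1 x hxA) (h ▸ g1 y (by tauto))).elim
    · exact (hd' _ (f1 y hyA) (h ▸ g1 x (by tauto))).elim
    · exact g2 x (by tauto) y (by tauto) h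
  · rw [Finset.card_union_of_disjoint hd, Finset.image_union]
    have e1 : A.image (fun v => if v ∈ A then f v else g v) = A.image f :=
      Finset.image_congr (fun x hx => by simp [Finset.mem_coe.mp hx])
    have e2 : B.image (fun v => if v ∈ A then f v else g v) = B.image g :=
      Finset.image_congr (fun x hx => by
        have : x ∉ A := fun h => hd' x h hx
        simp [this])
    rw [e1, e2]
    have := Finset.card_union_le (A.image f) (B.image g)
    omega

lemma Sav.mono {A B : Finset V} {k : ℕ} (hA : Sav H A k) (h : A ⊆ B) : Sav H B k := by
  have := hA.union (sav_zero (H := H) (B \ A)) Finset.disjoint_sdiff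
  rwa [Finset.union_sdiff_of_subset h] at this

lemma sav_clique {Q : Finset V} {q : V} (hq : q ∈ Q)
    (h : ∀ x ∈ Q, ∀ y ∈ Q, x ≠ y → H.Adj x y) : Sav H Q (Q.card - 1) := by
  refine ⟨fun _ => q, fun _ _ => hq, fun x hx y hy _ => ?_, ?_⟩
  · by_cases e : x = y
    · exact Or.inl e
    · exact Or.inr (h x hx y hy e)
  · have := Finset.card_pos.mpr ⟨q, hq⟩
    have h1 : (Q.image fun _ => q).card ≤ 1 :=
      Finset.card_le_one.mpr (by simp)
    omega

lemma sav_pair {x y : V} (h : H.Adj x y) : Sav H {x, y} 1 := by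
  have := sav_clique (H := H) (Q := {x, y}) (q := x) (by simp) (by
    have := h.symm; grind)
  rwa [Finset.card_pair h.ne] at this

lemma sav_tri {x y z : V} (h : H.Adj x y) (h1 : H.Adj x z) (h2 : H.Adj y z) :
    Sav H {x, y, z} 2 := by
  have := sav_clique (H := H) (Q := {x, y, z}) (q := x) (by simp) (by
    have := h.symm; have := h1.symm; have := h2.symm; grind)
  rwa [Finset.card_eq_three.mpr ⟨x, y, z, h.ne, h1.ne, h2.ne, rfl⟩] at this

/-- `σ` is a perfect matching on `A`. -/
def PM (H : SimpleGraph V) (σ : V → V) (A : Finset V) : Prop :=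
  ∀ x ∈ A, σ x ∈ A ∧ σ (σ x) = x ∧ H.Adj x (σ x)

lemma PM.remove {σ : V → V} {A : Finset V} (h : PM H σ A) {x : V} (hx : x ∈ A) :
    PM H σ (A \ {x, σ x}) := by
  intro y hy
  have := h x hx
  have := h y
  grind

lemma PM.add {σ : V → V} {A : Finset V} (h : PM H σ A) {x y : V} (hx : x ∉ A) (hy : y ∉ A)
    (hxy : H.Adj x y) : ∃ τ, PM H τ (A ∪ {x, y}) := by
  refine ⟨fun v => if v = x then y else if v = y then x else σ v, ?_⟩
  intro v hv
  have := h v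
  have := hxy.ne
  have := hxy.symm
  grind

lemma PM.card_remove {σ : V → V} {A : Finset V} (h : PM H σ A) {x : V} (hx : x ∈ A) :
    (A \ {x, σ x}).card + 2 = A.card := by
  have h1 := h x hx
  have hs : ({x, σ x} : Finset V) ⊆ A := by grind
  have := Finset.card_sdiff_add_card_eq_card hs
  rwa [Finset.card_pair h1.2.2.ne] at this

lemma PM.sav {σ : V → V} (m : ℕ) : ∀ {A : Finset V}, PM H σ A → 2 * m ≤ A.card → Sav H A m := by
  induction m with
  | zero => intro A _ _; exact sav_zero A
  | succ m ih =>
    intro A h hc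
    obtain ⟨x, hx⟩ := Finset.card_pos.mp (by omega : 0 < A.card)
    have h1 := h.card_remove hx
    have h2 := (ih (h.remove hx) (by omega)).union (sav_pair (h x hx).2.2) Finset.sdiff_disjoint
    refine h2.mono ?_
    have := h x hx
    grind

lemma PM.even {σ : V → V} (m : ℕ) : ∀ {A : Finset V}, PM H σ A → A.card = m → Even m := by
  induction m using Nat.strong_induction_on with
  | _ m ih =>
    intro A h hc
    rcases A.eq_empty_or_nonempty with rfl | ⟨x, hx⟩
    · simp at hc; subst hc; simp
    · have h1 := h.card_remove hx
      obtain ⟨k, hk⟩ := ih _ (by omega) (h.remove hx) rfl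
      exact ⟨k + 1, by omega⟩

lemma PM.card_image {σ : V → V} {A N : Finset V} (h : PM H σ A) (hN : N ⊆ A) :
    (N.image σ).card = N.card := by
  apply Finset.card_image_of_injOn
  intro x hx y hy e
  have h1 := (h x (hN hx)).2.1
  have h2 := (h y (hN hy)).2.1
  rw [← h1, ← h2, e]


lemma PM.mem_remove {σ : V → V} {A : Finset V} (h : PM H σ A) {x z : V} (hx : x ∈ A)
    (hz : z ∈ A) (h1 : z ≠ x) (h2 : z ≠ σ x) :
    z ∈ A \ {x, σ x} ∧ σ z ∈ A \ {x, σ x} := by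
  have := h x hx
  have := h z hz
  grind

lemma card_union_pair {C : Finset V} {x y : V} (hx : x ∉ C) (hy : y ∉ C) (hxy : H.Adj x y) :
    (C ∪ {x, y}).card = C.card + 2 := by
  rw [Finset.card_union_of_disjoint (by grind [Finset.disjoint_left]), Finset.card_pair hxy.ne]

/-- Adding an edge, with cardinality. -/
lemma PM.add' {A : Finset V} {x y : V} (h : ∃ σ, PM H σ A) (hx : x ∉ A) (hy : y ∉ A)
    (hxy : H.Adj x y) : (∃ τ, PM H τ (A ∪ {x, y})) ∧ (A ∪ {x, y}).card = A.card + 2 := by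
  obtain ⟨σ, h⟩ := h
  exact ⟨h.add hx hy hxy, card_union_pair hx hy hxy⟩

lemma aug_one {σ : V → V} {A : Finset V} (h : PM H σ A) {u v x : V} (hu : u ∉ A) (hv : v ∉ A)
    (huv : u ≠ v) (hx : x ∈ A) (hux : H.Adj u x) (hvx : H.Adj v (σ x)) :
    ∃ τ B, PM H τ B ∧ A.card < B.card := by
  have h1 := h.remove hx
  have h2 := h.card_remove hx
  obtain ⟨hx1, -, hx3⟩ := h x hx
  have hne := hx3.ne
  clear hx3
  obtain ⟨h3, c3⟩ := PM.add' ⟨_, h1⟩ (by grind) (by grind) hux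
  obtain ⟨⟨τ, h4⟩, c4⟩ := PM.add' h3 (by grind) (by grind) hvx
  exact ⟨τ, _, h4, by omega⟩

lemma aug_two {σ : V → V} {A : Finset V} (h : PM H σ A) {u v y y' : V} (hu : u ∉ A) (hv : v ∉ A)
    (huv : u ≠ v) (hy : y ∈ A) (hy' : y' ∈ A) (hux : H.Adj u (σ y)) (hvx : H.Adj v (σ y'))
    (hyy : H.Adj y y') (e1 : y' ≠ σ y) :
    ∃ τ B, PM H τ B ∧ A.card < B.card := by
  obtain ⟨hm1, hm2⟩ := h.mem_remove hy hy' hyy.ne' e1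
  have hr := (h.remove hy).remove hm1
  have hrc := (h.remove hy).card_remove hm1
  have hrc2 := h.card_remove hy
  obtain ⟨p1, p2, p3⟩ := h y hy
  obtain ⟨q1, q2, q3⟩ := h y' hy'
  have := hyy.ne
  have := p3.ne
  have := q3.ne
  clear p3 q3 p2
  obtain ⟨h1, c1⟩ := PM.add' ⟨_, hr⟩ (x := u) (y := σ y) (by grind) (by grind) hux
  obtain ⟨h2, c2⟩ := PM.add' h1 (x := v) (y := σ y') (by grind) (by grind) hvx
  obtain ⟨⟨τ, h3⟩, c3⟩ := PM.add' h2 (x := y) (y := y') (by grind) (by grind) hyy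
  exact ⟨τ, _, h3, by omega⟩

lemma aug_three {σ : V → V} {A : Finset V} (h : PM H σ A) {u v y y' a : V} (hu : u ∉ A)
    (hv : v ∉ A) (huv : u ≠ v) (ha : a ∈ A) (hy : y ∈ A \ {a, σ a}) (hy' : y' ∈ A \ {a, σ a})
    (hux : H.Adj u (σ y)) (hvx : H.Adj v (σ y'))
    (hay : H.Adj a y) (hby : H.Adj (σ a) y') (e : y' ≠ y) (e1 : y' ≠ σ y) :
    ∃ τ B, PM H τ B ∧ A.card < B.card := by
  have hra := h.remove ha
  have hrac := h.card_remove ha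
  obtain ⟨hm1, hm2⟩ := hra.mem_remove hy hy' e e1
  have hr := hra.remove hy
  have hr2 := hr.remove hm1
  have hrc := hra.card_remove hy
  have hrc2 := hr.card_remove hm1
  obtain ⟨a1, a2, a3⟩ := h a ha
  obtain ⟨p1, p2, p3⟩ := hra y hy
  obtain ⟨q1, q2, q3⟩ := hra y' hy'
  have := a3.ne
  have := p3.ne
  have := q3.ne
  generalize hC : ((A \ {a, σ a}) \ {y, σ y}) \ {y', σ y'} = C at *
  simp only [Finset.mem_sdiff, Finset.mem_insert, Finset.mem_singleton, not_or] at hy hy' p1 q1 hm2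
  have hCA : ∀ z, z ∈ C → z ∈ A ∧ z ≠ a ∧ z ≠ σ a ∧ z ≠ y ∧ z ≠ σ y ∧ z ≠ y' ∧ z ≠ σ y' := by
    intro z; rw [← hC]
    simp only [Finset.mem_sdiff, Finset.mem_insert, Finset.mem_singleton, not_or]
    tauto
  generalize σ a = b at *
  have e2 : σ y' ≠ y := hm2.2.1
  have e3 : σ y' ≠ σ y := hm2.2.2
  generalize σ y = x at *
  generalize σ y' = x' at *
  clear a3 p3 q3 p2 q2 a2 hra hr hC
  obtain ⟨h1, c1⟩ := PM.add' ⟨_, hr2⟩ (x := u) (y := x) (by grind) (by grind) hux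
  obtain ⟨h2, c2⟩ := PM.add' h1 (x := v) (y := x') (by grind) (by grind) hvx
  obtain ⟨h3, c3⟩ := PM.add' h2 (x := a) (y := y) (by grind) (by grind) hay
  obtain ⟨⟨τ, h4⟩, c4⟩ := PM.add' h3 (x := b) (y := y') (by grind) (by grind) hby
  exact ⟨τ, _, h4, by omega⟩

lemma sav_one_tri {σ : V → V} {A : Finset V} (h : PM H σ A) {m : ℕ} (hm : A.card = m + m)
    {u x : V} (hu : u ∉ A) (hx : x ∈ A) (hux : H.Adj u x) (hux' : H.Adj u (σ x)) :
    Sav H (A ∪ {u}) (m + 1) := by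
  have hrc := h.card_remove hx
  have hx' := h x hx
  have s1 : Sav H {u, x, σ x} 2 := sav_tri hux hux' hx'.2.2
  have s2 := (h.remove hx).sav (m - 1) (by omega)
  have s3 := s1.union s2 (by grind [Finset.disjoint_left])
  exact (s3.le (by omega)).mono (by grind)

lemma sav_two_tri {σ : V → V} {A : Finset V} (h : PM H σ A) {m : ℕ} (hm : A.card = m + m)
    {u x v z : V} (hu : u ∉ A) (hx : x ∈ A) (hux : H.Adj u x) (hux' : H.Adj u (σ x))
    (hv : v ∉ A) (huv : v ≠ u) (hz : z ∈ A \ {x, σ x}) (hvz : H.Adj v z) (hvz' : H.Adj v (σ z)) :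
    Sav H Finset.univ (m + 2) := by
  have hrc := h.card_remove hx
  have hx' := h x hx
  have s1 : Sav H {u, x, σ x} 2 := sav_tri hux hux' hx'.2.2
  have s2 := sav_one_tri (h.remove hx) (m := m - 1) (by omega) (u := v) (by grind) hz hvz hvz'
  have s3 := s1.union s2 (by grind [Finset.disjoint_left])
  exact (s3.le (by omega)).mono (Finset.subset_univ _)

lemma sav_tri_pair {σ : V → V} {A : Finset V} (h : PM H σ A) {m : ℕ} (hm : A.card = m + m)
    {u a y : V} (hu : u ∉ A) (ha : a ∈ A) (hy : y ∈ A \ {a, σ a}) (hay : H.Adj a y)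
    (hby : H.Adj (σ a) y) (hux : H.Adj u (σ y)) : Sav H Finset.univ (m + 1) := by
  have hrc := h.card_remove ha
  have hra := h.remove ha
  have hrc2 := hra.card_remove hy
  have hp := hra y hy
  have hpa := h a ha
  have s1 := sav_tri hpa.2.2 hay hby
  have s2 := sav_pair hux
  have s3 := (hra.remove hy).sav (m - 2) (by omega)
  have := hp.2.2.ne
  have s4 := s2.union s3 (by grind [Finset.disjoint_left])
  have s5 := s1.union s4 (by grind [Finset.disjoint_left])
  exact (s5.le (by omega)).mono (Finset.subset_univ _)

set_option maxHeartbeats 1000000 in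
/-- The case of at least two uncovered vertices. -/
lemma case_two [DecidableRel H.Adj] {d : ℕ} (hd : ∀ v, d ≤ H.degree v)
    {σ : V → V} {A : Finset V} (h : PM H σ A)
    (hmax : ∀ τ B, PM H τ B → B.card ≤ A.card) (hU : A.card + 2 ≤ Fintype.card V)
    (hns : ¬ Sav H Finset.univ (d + 2)) :
    ∃ I : Finset V, (∀ x ∈ I, ∀ y ∈ I, ¬ H.Adj x y) ∧
      Sav H Finset.univ (Fintype.card V - I.card) := by
  obtain ⟨m, hm⟩ := h.even _ rfl
  have hsav : Sav H A m := h.sav m (by omega)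
  have hmd : m ≤ d + 1 := by
    by_contra hc
    exact hns ((hsav.le (by omega)).mono (Finset.subset_univ _))
  -- U is independent
  have hUi : ∀ u, u ∉ A → ∀ v, v ∉ A → ¬ H.Adj u v := by
    intro u hu v hv huv
    obtain ⟨τ, hτ⟩ := h.add hu hv huv
    have := hmax _ _ hτ
    rw [card_union_pair hu hv huv] at this
    omega
  have hNA : ∀ u, u ∉ A → H.neighborFinset u ⊆ A := by
    intro u hu x hx
    by_contra hc
    exact hUi u hu x hc (by simpa using hx)
  -- augmenting paths of length three
  have aug1 : ∀ u, u ∉ A → ∀ v, v ∉ A → u ≠ v → ∀ x ∈ A, H.Adj u x → H.Adj v (σ x) → False := by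
    intro u hu v hv huv x hx hux hvx
    obtain ⟨τ, B, h1, h2⟩ := aug_one h hu hv huv hx hux hvx
    have := hmax _ _ h1
    omega
  -- degree counting
  have cnt : ∀ u, u ∉ A → ∀ v, v ∉ A → ∀ B ⊆ A, (∀ x, H.Adj u x → x ∈ B ∧ σ x ∈ B) →
      (∀ x, H.Adj v x → x ∈ B) →
      (∀ x ∈ A, H.Adj u x → H.Adj v (σ x) → False) → 2 * d ≤ B.card := by
    intro u hu v hv B hB hu1 hv1 hne
    have h1 := h.card_image (hNA u hu)
    have h2 : ((H.neighborFinset u).image σ ∪ H.neighborFinset v) ⊆ B := by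
      intro z hz
      simp only [Finset.mem_union, Finset.mem_image, mem_neighborFinset] at hz
      rcases hz with ⟨w, hw, rfl⟩ | hz
      · exact (hu1 w hw).2
      · exact hv1 z hz
    have h3 := Finset.card_le_card h2
    rw [Finset.card_union_of_disjoint, h1, card_neighborFinset_eq_degree,
      card_neighborFinset_eq_degree] at h3
    · have := hd u; have := hd v; omega
    · rw [Finset.disjoint_left]
      intro z hz hz'
      simp only [Finset.mem_image, mem_neighborFinset] at hz hz'
      obtain ⟨w, hw, rfl⟩ := hz
      exact hne w (hNA u hu (by simpa using hw)) hw hz'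
  have two : ∀ u, u ∉ A → ∃ v, v ∉ A ∧ v ≠ u := by
    intro u hu
    by_contra! hc
    have h1 : (Finset.univ : Finset V) ⊆ insert u A := by
      intro z _
      by_cases hz : z ∈ A
      · simp [hz]
      · simp [hc z hz]
    have := Finset.card_le_card h1
    rw [Finset.card_insert_of_notMem hu, Finset.card_univ] at this
    omega
  obtain ⟨u0, hu0⟩ : ∃ u, u ∉ A := by
    by_contra! hc
    have := Finset.card_le_card (fun z (_ : z ∈ Finset.univ) => hc z)
    rw [Finset.card_univ] at this
    omega
  obtain ⟨u1, hu1, hu01⟩ := two u0 hu0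
  have hadjA : ∀ u, u ∉ A → ∀ x, H.Adj u x → x ∈ A := fun u hu x hx =>
    hNA u hu (by simpa using hx)
  have hdm : d ≤ m := by
    have := cnt u0 hu0 u1 hu1 A subset_rfl
      (fun x hx => ⟨hadjA _ hu0 _ hx, (h x (hadjA _ hu0 _ hx)).1⟩)
      (fun x hx => hadjA _ hu1 _ hx) (aug1 u0 hu0 u1 hu1 hu01.symm)
    omega
  -- no triangles
  have notri : ∀ u, u ∉ A → ∀ x ∈ A, H.Adj u x → H.Adj u (σ x) → False := by
    intro u hu x hx hux hux'
    have hx' := h x hx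
    have hr := h.remove hx
    have hrc := h.card_remove hx
    have s3 := sav_one_tri h hm hu hx hux hux'
    rcases Nat.lt_or_ge d m with hlt | hge
    · exact hns ((s3.le (by omega)).mono (Finset.subset_univ _))
    obtain ⟨v, hv, hvu⟩ := two u hu
    have hvx : ∀ z, H.Adj v z → z ∈ A \ {x, σ x} ∧ σ z ∈ A \ {x, σ x} := by
      intro z hz
      have hzA := hadjA v hv z hz
      have a1 := aug1 u hu v hv hvu.symm x hx hux
      have a2 := aug1 v hv u hu hvu x hx
      have h1 : z ≠ x := by rintro rfl; exact a2 hz hux'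
      have h2 : z ≠ σ x := by rintro rfl; exact a1 hz
      exact h.mem_remove hx hzA h1 h2
    have : ∃ z ∈ A, H.Adj v z ∧ H.Adj v (σ z) := by
      by_contra! hc
      have := cnt v hv v hv _ Finset.sdiff_subset hvx (fun z hz => (hvx z hz).1)
        (fun z hz h1 h2 => hc z hz h1 h2)
      have := Finset.card_pos.mpr ⟨x, hx⟩
      omega
    obtain ⟨z, hz, hvz, hvz'⟩ := this
    have hzB := (hvx z hvz)
    have s7 := sav_two_tri h hm hu hx hux hux' hv hvu hzB.1 hvz hvz'
    exact hns (s7.le (by omega))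
  obtain ⟨X, hX⟩ : ∃ X : Finset V, ∀ x, x ∈ X ↔ x ∈ A ∧ ∃ u, u ∉ A ∧ H.Adj u x := by
    classical
    exact ⟨A.filter (fun x => ∃ u, u ∉ A ∧ H.Adj u x), by simp⟩
  have hXA : X ⊆ A := fun x hx => ((hX x).mp hx).1
  have hXσ : ∀ x ∈ X, σ x ∉ X := by
    intro x hx hx'
    obtain ⟨hxA, u, hu, hux⟩ := (hX x).mp hx
    obtain ⟨_, v, hv, hvx⟩ := (hX _).mp hx'
    by_cases e : u = v
    · subst e; exact notri u hu x hxA hux hvx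
    · exact aug1 u hu v hv e x hxA hux hvx
  obtain ⟨Y, hY⟩ : ∃ Y : Finset V, ∀ y, y ∈ Y ↔ y ∈ A ∧ σ y ∈ X :=
    ⟨A.filter (fun y => σ y ∈ X), by simp⟩
  have hYX : Y = X.image σ := by
    ext y
    rw [hY, Finset.mem_image]
    constructor
    · rintro ⟨h1, h2⟩
      exact ⟨σ y, h2, (h y h1).2.1⟩
    · rintro ⟨x, h1, rfl⟩
      have := h x (hXA h1)
      exact ⟨this.1, by rwa [this.2.1]⟩
  have hYc : Y.card = X.card := by rw [hYX, h.card_image hXA]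
  have hXY : Disjoint X Y := by
    rw [Finset.disjoint_left]
    intro x hx hy
    exact hXσ x hx ((hY x).mp hy).2
  -- no edges between Y and U
  have hYU : ∀ y ∈ Y, ∀ u, u ∉ A → ¬ H.Adj u y := by
    intro y hy u hu huy
    have h1 := (hY y).mp hy
    exact Finset.disjoint_left.mp hXY ((hX y).mpr ⟨h1.1, u, hu, huy⟩) hy
  -- different private neighbours
  have sdr : ∀ x ∈ X, ∀ x' ∈ X, x ≠ x' →
      ∃ u, u ∉ A ∧ ∃ v, v ∉ A ∧ u ≠ v ∧ H.Adj u x ∧ H.Adj v x' := by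
    intro x hx x' hx' hne
    by_contra! hc
    obtain ⟨hxA, u, hu, hux⟩ := (hX x).mp hx
    obtain ⟨hxA', v, hv, hvx⟩ := (hX x').mp hx'
    have huv : u = v := by
      by_contra e
      exact hc u hu v hv e hux hvx
    subst huv
    obtain ⟨w, hw, hwu⟩ := two u hu
    have hwx : ¬ H.Adj w x := fun e => hc w hw u hu hwu e hvx
    have hwx' : ¬ H.Adj w x' := fun e => hc u hu w hw hwu.symm hux e
    have hp := h x hxA
    have hp' := h x' hxA'
    have e1 : x' ≠ σ x := by rintro rfl; exact hXσ x hx hx'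
    have hx'm := (h.mem_remove hxA hxA' hne.symm e1).1
    have hr := (h.remove hxA).card_remove hx'm
    have hrc := h.card_remove hxA
    have key : ∀ z, H.Adj w z → z ∈ (A \ {x, σ x}) \ {x', σ x'} ∧
        σ z ∈ (A \ {x, σ x}) \ {x', σ x'} := by
      intro z hz
      have hzA := hadjA w hw z hz
      have h1 : z ≠ x := by rintro rfl; exact hwx hz
      have h2 : z ≠ x' := by rintro rfl; exact hwx' hz
      have h3 : z ≠ σ x := by rintro rfl; exact aug1 u hu w hw hwu.symm x hxA hux hz
      have h4 : z ≠ σ x' := by rintro rfl; exact aug1 u hu w hw hwu.symm x' hxA' hvx hz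
      have h5 := h.mem_remove hxA hzA h1 h3
      exact (h.remove hxA).mem_remove hx'm h5.1 h2 h4
    have := cnt w hw w hw _ (Finset.sdiff_subset.trans Finset.sdiff_subset) key
      (fun z hz => (key z hz).1) (notri w hw)
    omega
  -- Y independent
  have hYY : ∀ y ∈ Y, ∀ y' ∈ Y, ¬ H.Adj y y' := by
    intro y hy y' hy' hyy
    have hy1 := (hY y).mp hy
    have hy1' := (hY y').mp hy'
    have hp := h y hy1.1
    have hp' := h y' hy1'.1
    have hne : σ y ≠ σ y' := by
      intro e
      apply hyy.ne
      rw [← hp.2.1, ← hp'.2.1, e]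
    have e1 : y' ≠ σ y := by
      rintro rfl
      exact Finset.disjoint_left.mp hXY hy1.2 hy'
    obtain ⟨u, hu, v, hv, huv, hux, hvx⟩ := sdr _ hy1.2 _ hy1'.2 hne
    obtain ⟨τ, B, h1, h2⟩ := aug_two h hu hv huv hy1.1 hy1'.1 hux hvx hyy e1
    have := hmax _ _ h1
    omega
  have hYA : Y ⊆ A := fun y hy => ((hY y).mp hy).1
  have hYUd : Disjoint Y Aᶜ := by
    rw [Finset.disjoint_left]; intro y hy hy'
    exact Finset.mem_compl.mp hy' (hYA hy)
  have hAc := Finset.card_compl A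
  have hYUi : ∀ x ∈ Y ∪ Aᶜ, ∀ y ∈ Y ∪ Aᶜ, ¬ H.Adj x y := by
    intro x hx y hy hxy
    simp only [Finset.mem_union, Finset.mem_compl] at hx hy
    rcases hx with hx | hx <;> rcases hy with hy | hy
    · exact hYY x hx y hy hxy
    · exact hYU x hx y hy hxy.symm
    · exact hYU y hy x hx hxy
    · exact hUi x hx y hy hxy
  have hXYc : (X ∪ Y).card = 2 * Y.card := by
    rw [Finset.card_union_of_disjoint hXY]; omega
  by_cases hcov : A ⊆ X ∪ Y
  · refine ⟨Y ∪ Aᶜ, hYUi, ?_⟩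
    have := Finset.card_le_card hcov
    refine (hsav.le ?_).mono (Finset.subset_univ _)
    rw [Finset.card_union_of_disjoint hYUd]
    omega
  obtain ⟨a, haA, haXY⟩ := Finset.not_subset.mp hcov
  simp only [Finset.mem_union, not_or] at haXY
  have hpa := h a haA
  obtain ⟨b, hb⟩ : ∃ b, b = σ a := ⟨_, rfl⟩
  rw [← hb] at hpa
  have hbX : b ∉ X := fun e => haXY.2 ((hY a).mpr ⟨haA, hb ▸ e⟩)
  have hbY : b ∉ Y := fun e => haXY.1 (hpa.2.1 ▸ ((hY b).mp e).2)
  have hra := h.remove haA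
  have hrac := h.card_remove haA
  rw [← hb] at hra hrac
  have hua : ∀ u, u ∉ A → ∀ x, H.Adj u x → x ∈ A \ {a, b} ∧ σ x ∈ A \ {a, b} := by
    intro u hu x hx
    have hxA := hadjA u hu x hx
    have hxX := (hX x).mpr ⟨hxA, u, hu, hx⟩
    have h1 : x ≠ a := by rintro rfl; exact haXY.1 hxX
    have h2 : x ≠ b := by rintro rfl; exact hbX hxX
    subst hb
    exact h.mem_remove haA hxA h1 h2
  have hmd1 : m = d + 1 := by
    have := cnt u0 hu0 u0 hu0 _ Finset.sdiff_subset (hua u0 hu0) (fun x hx => (hua u0 hu0 x hx).1)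
      (notri u0 hu0)
    omega
  have hfull : ∀ x ∈ X, ∀ u, u ∉ A → H.Adj u x := by
    intro x hx u hu
    by_contra hc
    have hxA := hXA hx
    have hpx := h x hxA
    have hxB : x ∈ A \ {a, b} := by
      have h1 : x ≠ a := by rintro rfl; exact haXY.1 hx
      have h2 : x ≠ b := by rintro rfl; exact hbX hx
      simp [hxA, h1, h2]
    have key : ∀ z, H.Adj u z → z ∈ (A \ {a, b}) \ {x, σ x} ∧ σ z ∈ (A \ {a, b}) \ {x, σ x} := by
      intro z hz
      have h1 := hua u hu z hz
      have hzA := hadjA u hu z hz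
      have hzX := (hX z).mpr ⟨hzA, u, hu, hz⟩
      have h2 : z ≠ x := by rintro rfl; exact hc hz
      have h3 : z ≠ σ x := by rintro rfl; exact hXσ x hx hzX
      exact hra.mem_remove hxB h1.1 h2 h3
    have := cnt u hu u hu _ (Finset.sdiff_subset.trans Finset.sdiff_subset) key
      (fun z hz => (key z hz).1) (notri u hu)
    have := hra.card_remove hxB
    omega
  have hXYeq : X ∪ Y = A \ {a, b} := by
    apply Finset.Subset.antisymm
    · intro z hz
      have h0 : z ∈ A := by
        rcases Finset.mem_union.mp hz with e | e
        · exact hXA e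
        · exact hYA e
      rw [Finset.mem_union] at hz
      have h1 : z ≠ a := by rintro rfl; exact hz.elim haXY.1 haXY.2
      have h2 : z ≠ b := by rintro rfl; exact hz.elim hbX hbY
      simp [h0, h1, h2]
    · intro z hz
      by_contra hzc
      have hzA : z ∈ A := (Finset.mem_sdiff.mp hz).1
      have key : ∀ w, H.Adj u0 w → w ∈ (A \ {a, b}) \ {z, σ z} ∧
          σ w ∈ (A \ {a, b}) \ {z, σ z} := by
        intro w hw
        have h1 := hua u0 hu0 w hw
        have hwA := hadjA u0 hu0 w hw
        have hwX := (hX w).mpr ⟨hwA, u0, hu0, hw⟩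
        have h2 : w ≠ z := by rintro rfl; exact hzc (Finset.mem_union_left _ hwX)
        have h3 : w ≠ σ z := by rintro rfl; exact hzc (Finset.mem_union_right _ ((hY z).mpr ⟨hzA, hwX⟩))
        exact hra.mem_remove hz h1.1 h2 h3
      have := cnt u0 hu0 u0 hu0 _ (Finset.sdiff_subset.trans Finset.sdiff_subset) key
        (fun z hz => (key z hz).1) (notri u0 hu0)
      have := hra.card_remove hz
      omega
  have hnone : (∀ y ∈ Y, ¬ H.Adj a y) ∨ (∀ y ∈ Y, ¬ H.Adj b y) := by
    by_contra! hc
    obtain ⟨⟨y, hy, hay⟩, ⟨y', hy', hby⟩⟩ := hc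
    have hy1 := (hY y).mp hy
    have hy1' := (hY y').mp hy'
    have hp := h y hy1.1
    have hp' := h y' hy1'.1
    have hyB : y ∈ A \ {a, b} := by rw [← hXYeq]; exact Finset.mem_union_right _ hy
    have hyB' : y' ∈ A \ {a, b} := by rw [← hXYeq]; exact Finset.mem_union_right _ hy'
    rw [hb] at hyB hyB' hby
    by_cases e : y = y'
    · subst e
      exact hns ((sav_tri_pair h hm hu0 haA hyB hay hby (hfull _ hy1.2 u0 hu0)).le (by omega))
    · have e1 : y' ≠ σ y := by
        rintro rfl
        exact Finset.disjoint_left.mp hXY hy1.2 hy'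
      obtain ⟨τ, B, h1, h2⟩ := aug_three h hu0 hu1 hu01.symm haA hyB hyB'
        (hfull _ hy1.2 u0 hu0) (hfull _ hy1'.2 u1 hu1) hay hby (Ne.symm e) e1
      have := hmax _ _ h1
      omega
  have fin : ∀ c ∈ A, c ∉ X → c ∉ Y → (∀ y ∈ Y, ¬ H.Adj c y) →
      ∃ I : Finset V, (∀ x ∈ I, ∀ y ∈ I, ¬ H.Adj x y) ∧
      Sav H Finset.univ (Fintype.card V - I.card) := by
    intro c hc hcX hcY hcn
    have hcU : ∀ u, u ∉ A → ¬ H.Adj c u := fun u hu e => hcX ((hX c).mpr ⟨hc, u, hu, e.symm⟩)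
    have hcYU : ∀ y ∈ Y ∪ Aᶜ, ¬ H.Adj c y := by
      intro y hy
      simp only [Finset.mem_union, Finset.mem_compl] at hy
      exact hy.elim (hcn y) (hcU y)
    refine ⟨insert c (Y ∪ Aᶜ), ?_, ?_⟩
    · intro x hx y hy hxy
      rcases Finset.mem_insert.mp hx with hx2 | hx2 <;>
        rcases Finset.mem_insert.mp hy with hy2 | hy2
      · exact hxy.ne (hx2.trans hy2.symm)
      · exact hcYU y hy2 (hx2 ▸ hxy)
      · exact hcYU x hx2 (hy2 ▸ hxy.symm)
      · exact hYUi x hx2 y hy2 hxy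
    · rw [Finset.card_insert_of_notMem (by simp [hc, hcY]), Finset.card_union_of_disjoint hYUd]
      refine (hsav.le ?_).mono (Finset.subset_univ _)
      rw [hXYeq] at hXYc
      omega
  rcases hnone with hn | hn
  · exact fin a haA haXY.1 haXY.2 hn
  · exact fin b hpa.1 hbX hbY hn

/-- An edge inside `W` avoiding a small set. -/
lemma edge_avoid [DecidableRel H.Adj] {W T : Finset V} (hW : W.Nonempty)
    (hdeg : ∀ w ∈ W, 6 ≤ (H.neighborFinset w ∩ W).card) (hT : T.card ≤ 4) :
    ∃ x y, x ∈ W \ T ∧ y ∈ W \ T ∧ H.Adj x y := by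
  have big : ∀ S : Finset V, 6 ≤ S.card → ∃ z ∈ S, z ∉ T := by
    intro S hS
    by_contra! hc
    have := Finset.card_le_card hc
    omega
  obtain ⟨w, hw⟩ := hW
  obtain ⟨x, hx, hxT⟩ := big _ (hdeg w hw)
  have hxW := (Finset.mem_inter.mp hx).2
  obtain ⟨y, hy, hyT⟩ := big _ (hdeg x hxW)
  rw [Finset.mem_inter, mem_neighborFinset] at hy
  exact ⟨x, y, by simp [hxW, hxT], by simp [hy.2, hyT], hy.1⟩

lemma sav_three [DecidableRel H.Adj] {W : Finset V} (hW : W.Nonempty)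
    (hdeg : ∀ w ∈ W, 6 ≤ (H.neighborFinset w ∩ W).card) : Sav H W 3 := by
  obtain ⟨a, b, ha, hb, hab⟩ := edge_avoid (T := ∅) hW hdeg (by simp)
  obtain ⟨a', b', ha', hb', hab'⟩ := edge_avoid (T := {a, b}) hW hdeg
    (by rw [Finset.card_pair hab.ne]; omega)
  obtain ⟨p, q, hp, hq, hpq⟩ := edge_avoid (T := {a, b} ∪ {a', b'}) hW hdeg
    ((Finset.card_union_le _ _).trans
      (by rw [Finset.card_pair hab.ne, Finset.card_pair hab'.ne]))
  clear hdeg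
  have s := ((sav_pair hab).union (sav_pair hab') (by grind [Finset.disjoint_left])).union
    (sav_pair hpq) (by grind [Finset.disjoint_left])
  have pr : ∀ {x y : V}, x ∈ W → y ∈ W → ({x, y} : Finset V) ⊆ W := by
    intro x y hx hy z hz
    rcases Finset.mem_insert.mp hz with rfl | hz
    · exact hx
    · rw [Finset.mem_singleton.mp hz]; exact hy
  rw [Finset.mem_sdiff] at ha hb ha' hb' hp hq
  exact s.mono (Finset.union_subset (Finset.union_subset (pr ha.1 hb.1) (pr ha'.1 hb'.1))
    (pr hp.1 hq.1))

/-- The case with a triangle and few vertices. -/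
lemma case_tri [DecidableRel H.Adj] {d : ℕ} (hd : ∀ v, d ≤ H.degree v)
    (hn : d + 10 ≤ Fintype.card V) (hn2 : Fintype.card V ≤ 2 * d + 3)
    (hdf : ∀ x y v z, H.Adj x y → H.Adj x v → H.Adj x z → H.Adj y v → H.Adj y z → v ≠ z →
      H.Adj v z)
    (htri : ¬ H.CliqueFree 3) : Sav H Finset.univ (d + 2) := by
  obtain ⟨Q, hQ, hQm⟩ : ∃ Q : Finset V, H.IsClique (Q : Set V) ∧
      ∀ R : Finset V, H.IsClique (R : Set V) → R.card ≤ Q.card := by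
    classical
    obtain ⟨Q, hQ, hm⟩ := Finset.exists_max_image
      (Finset.univ.filter (fun R : Finset V => H.IsClique (R : Set V))) Finset.card
      ⟨∅, by simp⟩
    exact ⟨Q, (Finset.mem_filter.mp hQ).2, fun R hR => hm R (by simp [hR])⟩
  have h3 : 3 ≤ Q.card := by
    simp only [CliqueFree, not_forall, not_not] at htri
    obtain ⟨R, hR⟩ := htri
    have := hQm R hR.isClique
    rw [hR.card_eq] at this
    exact this
  have hQa : ∀ x ∈ Q, ∀ y ∈ Q, x ≠ y → H.Adj x y := fun x hx y hy e =>
    hQ (Finset.mem_coe.mpr hx) (Finset.mem_coe.mpr hy) e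
  obtain ⟨q, hq⟩ := Finset.card_pos.mp (by omega : 0 < Q.card)
  -- outside vertices have at most one neighbour in Q
  have one : ∀ v, v ∉ Q → ∀ x ∈ Q, ∀ y ∈ Q, H.Adj v x → H.Adj v y → x = y := by
    intro v hv x hx y hy hvx hvy
    by_contra e
    have hcl : H.IsClique ((insert v Q : Finset V) : Set V) := by
      rw [Finset.coe_insert]
      refine hQ.insert ?_
      intro z hz _
      by_cases e1 : z = x
      · exact e1 ▸ hvx
      by_cases e2 : z = y
      · exact e2 ▸ hvy
      exact hdf x y v z (hQa x hx y hy e) hvx.symm (hQa x hx z hz (Ne.symm e1)) hvy.symm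
        (hQa y hy z hz (Ne.symm e2)) (fun e3 => hv (e3 ▸ hz))
    have := hQm _ hcl
    rw [Finset.card_insert_of_notMem hv] at this
    omega
  have hout : ∀ x ∈ Q, d + 1 ≤ (H.neighborFinset x \ Q).card + Q.card := by
    intro x hx
    have h1 : H.neighborFinset x ⊆ (H.neighborFinset x \ Q) ∪ Q.erase x := by
      intro z hz
      by_cases hzQ : z ∈ Q
      · have : z ≠ x := by
          rintro rfl
          simp at hz
        simp [hzQ, this]
      · exact Finset.mem_union_left _ (Finset.mem_sdiff.mpr ⟨hz, hzQ⟩)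
    have h2 := (Finset.card_le_card h1).trans (Finset.card_union_le _ _)
    rw [card_neighborFinset_eq_degree, Finset.card_erase_of_mem hx] at h2
    have := hd x
    omega
  have hlarge : d ≤ Q.card := by
    by_contra! hlt
    have h1 : (Q.biUnion fun x => H.neighborFinset x \ Q).card =
        ∑ x ∈ Q, (H.neighborFinset x \ Q).card := by
      apply Finset.card_biUnion
      intro x hx y hy e
      change Disjoint (H.neighborFinset x \ Q) (H.neighborFinset y \ Q)
      rw [Finset.disjoint_left]
      intro z hz hz'
      simp only [Finset.mem_sdiff, mem_neighborFinset] at hz hz'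
      exact e (one z hz.2 x hx y hy hz.1.symm hz'.1.symm)
    have h2 : Q.card * (d + 1 - Q.card) ≤ ∑ x ∈ Q, (H.neighborFinset x \ Q).card := by
      rw [← smul_eq_mul]
      apply Finset.card_nsmul_le_sum
      intro x hx
      have := hout x hx
      omega
    have h3' : (Q ∪ Q.biUnion fun x => H.neighborFinset x \ Q).card ≤ Fintype.card V :=
      Finset.card_le_univ _
    rw [Finset.card_union_of_disjoint, h1] at h3'
    · obtain ⟨e, he⟩ : ∃ e, d = Q.card + 1 + e := ⟨d - Q.card - 1, by omega⟩
      obtain ⟨c, hc⟩ : ∃ c, Q.card = 3 + c := ⟨Q.card - 3, by omega⟩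
      have h5 : d + 1 - Q.card = e + 2 := by omega
      rw [h5, hc] at h2
      have h6 : (3 + c) * (e + 2) = 6 + 3 * e + 2 * c + c * e := by ring
      rw [h6] at h2
      have := Nat.zero_le (c * e)
      omega
    · rw [Finset.disjoint_left]
      intro z hz hz'
      simp only [Finset.mem_biUnion, Finset.mem_sdiff] at hz'
      obtain ⟨_, _, _, h⟩ := hz'
      exact h hz
  by_cases hW : Qᶜ.Nonempty
  · have s1 := sav_clique hq hQa
    have s2 : Sav H Qᶜ 3 := by
      apply sav_three hW
      intro w hw
      have hwQ := Finset.mem_compl.mp hw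
      have h1 : H.neighborFinset w ⊆ (H.neighborFinset w ∩ Qᶜ) ∪ (H.neighborFinset w ∩ Q) := by
        intro z hz
        by_cases hzQ : z ∈ Q
        · exact Finset.mem_union_right _ (Finset.mem_inter.mpr ⟨hz, hzQ⟩)
        · exact Finset.mem_union_left _ (Finset.mem_inter.mpr ⟨hz, Finset.mem_compl.mpr hzQ⟩)
      have h2 := (Finset.card_le_card h1).trans (Finset.card_union_le _ _)
      have h4 : (H.neighborFinset w ∩ Q).card ≤ 1 := by
        rw [Finset.card_le_one]
        intro x hx y hy
        simp only [Finset.mem_inter, mem_neighborFinset] at hx hy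
        exact one w hwQ x hx.2 y hy.2 hx.1 hy.1
      rw [card_neighborFinset_eq_degree] at h2
      have := hd w
      omega
    have s3 := s1.union s2 disjoint_compl_right
    exact (s3.le (by omega)).mono (Finset.subset_univ _)
  · rw [Finset.not_nonempty_iff_eq_empty, Finset.compl_eq_empty_iff] at hW
    have s1 := sav_clique hq hQa
    have : Q.card = Fintype.card V := by rw [hW, Finset.card_univ]
    exact (s1.le (by omega)).mono (Finset.subset_univ _)

lemma main_compl [DecidableRel H.Adj] {d : ℕ} (hd : ∀ v, d ≤ H.degree v)
    (hn : d + 10 ≤ Fintype.card V)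
    (hdf : ∀ x y v z, H.Adj x y → H.Adj x v → H.Adj x z → H.Adj y v → H.Adj y z → v ≠ z →
      H.Adj v z) :
    Sav H Finset.univ (d + 2) ∨ ∃ I : Finset V, (∀ x ∈ I, ∀ y ∈ I, ¬ H.Adj x y) ∧
      Sav H Finset.univ (Fintype.card V - I.card) := by
  by_cases hns : Sav H Finset.univ (d + 2)
  · exact Or.inl hns
  right
  obtain ⟨A, ⟨σ, h⟩, hmax⟩ : ∃ A : Finset V, (∃ σ, PM H σ A) ∧
      ∀ τ B, PM H τ B → B.card ≤ A.card := by
    classical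
    obtain ⟨Q, hQ, hm⟩ := Finset.exists_max_image
      (Finset.univ.filter (fun R : Finset V => ∃ σ, PM H σ R)) Finset.card
      ⟨∅, Finset.mem_filter.mpr ⟨Finset.mem_univ _, id, fun x hx => by simp at hx⟩⟩
    exact ⟨Q, (Finset.mem_filter.mp hQ).2, fun τ R hR => hm R (by
      rw [Finset.mem_filter]; exact ⟨Finset.mem_univ _, τ, hR⟩)⟩
  by_cases hU : A.card + 2 ≤ Fintype.card V
  · exact case_two hd h hmax hU hns
  obtain ⟨m, hm⟩ := h.even _ rfl
  have hsav : Sav H Finset.univ m := (h.sav m (by omega)).mono (Finset.subset_univ _)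
  have hmd : m ≤ d + 1 := by
    by_contra hc
    exact hns (hsav.le (by omega))
  by_cases htri : H.CliqueFree 3
  · haveI : Nonempty V := Fintype.card_pos_iff.mp (by omega)
    have hmin : d ≤ H.minDegree := H.le_minDegree_of_forall_le_degree d hd
    have hcol : H.Colorable 2 := by
      apply colorable_of_cliqueFree_lt_minDegree htri
      refine lt_of_lt_of_le ?_ hmin
      rw [Nat.div_lt_iff_lt_mul (by norm_num)]
      omega
    obtain ⟨C⟩ := hcol
    have key : ∀ c : Fin 2, ∀ x ∈ Finset.univ.filter (fun v => C v = c),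
        ∀ y ∈ Finset.univ.filter (fun v => C v = c), ¬ H.Adj x y := by
      intro c x hx y hy hxy
      simp only [Finset.mem_filter, Finset.mem_univ, true_and] at hx hy
      exact C.valid hxy (hx.trans hy.symm)
    have hsum : (Finset.univ.filter (fun v => C v = 0)).card +
        (Finset.univ.filter (fun v => C v = 1)).card = Fintype.card V := by
      have h1 := Finset.card_filter_add_card_filter_not (s := (Finset.univ : Finset V))
        (fun v => C v = 0)
      rw [Finset.card_univ] at h1
      have h2 : (Finset.univ.filter (fun v => ¬ C v = 0)) =
          (Finset.univ.filter (fun v => C v = 1)) := by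
        ext v
        simp only [Finset.mem_filter, Finset.mem_univ, true_and]
        generalize C v = c
        revert c
        decide
      rw [← h2]
      exact h1
    rcases le_total (Finset.univ.filter (fun v => C v = 0)).card
      (Finset.univ.filter (fun v => C v = 1)).card with hle | hle
    · exact ⟨_, key 1, hsav.le (by omega)⟩
    · exact ⟨_, key 0, hsav.le (by omega)⟩
  · exact (hns (case_tri hd hn (by omega) hdf htri)).elim

lemma Sav.colorable {G : SimpleGraph V} {k : ℕ} (h : Sav Gᶜ Finset.univ k) :
    G.Colorable (Fintype.card V - k) := by
  obtain ⟨f, -, h2, h3⟩ := h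
  let C : G.Coloring {v // v ∈ Finset.univ.image f} :=
    Coloring.mk (fun v => ⟨f v, Finset.mem_image_of_mem f (Finset.mem_univ v)⟩) (by
      intro v w hvw e
      rcases h2 v (Finset.mem_univ _) w (Finset.mem_univ _) (Subtype.mk.inj e) with h | h
      · exact hvw.ne h
      · exact ((compl_adj G v w).mp h).2 hvw)
  refine C.colorable.mono ?_
  rw [Fintype.card_coe]
  rw [Finset.card_univ] at h3
  omega

end BK

theorem borodin_kostochka_K2_2K1_free
    {V : Type*} [Fintype V]
    (G : SimpleGraph V) [DecidableRel G.Adj]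
    (hΔ : 9 ≤ G.maxDegree)
    (hfree : ¬ Nonempty (K2Union2K1 ↪g G)) :
    G.chromaticNumber ≤ (↑(max (G.maxDegree - 1) G.cliqueNum) : ℕ∞) := by
  classical
  have hdf : ∀ x y v z, Gᶜ.Adj x y → Gᶜ.Adj x v → Gᶜ.Adj x z → Gᶜ.Adj y v → Gᶜ.Adj y z → v ≠ z →
      Gᶜ.Adj v z := by
    intro x y v z hxy hxv hxz hyv hyz hvz
    rw [compl_adj]
    refine ⟨hvz, fun hadj => hfree ?_⟩
    rw [compl_adj] at hxy hxv hxz hyv hyz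
    refine ⟨⟨⟨![v, z, x, y], ?_⟩, ?_⟩⟩
    · intro i j hij
      fin_cases i <;> fin_cases j <;> simp_all
    · intro i j
      change G.Adj (![v, z, x, y] i) (![v, z, x, y] j) ↔ K2Union2K1.Adj i j
      clear hfree
      have a1 := hadj.symm
      have b1 := fun h : G.Adj y x => hxy.2 h.symm
      have b2 := fun h : G.Adj v x => hxv.2 h.symm
      have b3 := fun h : G.Adj z x => hxz.2 h.symm
      have b4 := fun h : G.Adj v y => hyv.2 h.symm
      have b5 := fun h : G.Adj z y => hyz.2 h.symm
      fin_cases i <;> fin_cases j <;> simp_all [K2Union2K1]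
  haveI : Nonempty V := by
    by_contra hne
    rw [not_nonempty_iff] at hne
    have : G.maxDegree = 0 := by simp
    omega
  have hlt := G.maxDegree_lt_card_verts
  have hd : ∀ v, Fintype.card V - 1 - G.maxDegree ≤ Gᶜ.degree v := by
    intro v
    rw [degree_compl]
    have := G.degree_le_maxDegree v
    omega
  rcases main_compl hd (by omega) hdf with h | ⟨I, hI, h⟩
  · have hc := h.colorable
    have hc2 : G.Colorable (max (G.maxDegree - 1) G.cliqueNum) :=
      hc.mono (le_trans (by omega) (le_max_left _ _))
    exact hc2.chromaticNumber_le
  · have hc := h.colorable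
    have hcl : G.IsClique (I : Set V) := by
      intro x hx y hy e
      by_contra hn
      exact hI x hx y hy ((compl_adj G x y).mpr ⟨e, hn⟩)
    have h1 : I.card ≤ G.cliqueNum := hcl.card_le_cliqueNum
    have h2 := Finset.card_le_univ I
    have hc2 : G.Colorable (max (G.maxDegree - 1) G.cliqueNum) :=
      hc.mono (le_trans (by omega) (le_max_right _ _))
    exact hc2.chromaticNumber_le
end
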